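/- With the constants C, c and setup of the local well-posedness theorem (initial vorticity ω₀ ∈ W^{1,1}(ℝ²) with ‖ω₀‖_{W^{1,1}} ≤ A₀ and t₀ = C/A₀²): the solution depends continuously on the initial data, i.e. if ω₀^{(i)} is a sequence of initial data with ‖ω₀^{(i)}‖_{W^{1,1}(ℝ²)} ≤ A₀ converging in W^{1,1}(ℝ²) to ω₀, and ω^{(i)}, ω are the corresponding mild solutions of the vorticity equation on (0, t₀], then sup_{0<t≤t₀} ‖ω^{(i)}(·,t) − ω(·,t)‖_{W^{1,1}(ℝ²)} → 0 as i → ∞. -/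

import Mathlib

open MeasureTheory Real Filter
open scoped ENNReal RealInnerProductSpace Topology

noncomputable section

abbrev E2 := EuclideanSpace ℝ (Fin 2)

/-- The two-dimensional heat kernel. -/
def K (t : ℝ) (x : E2) : ℝ := (4 * π * t)⁻¹ * Real.exp (-‖x‖ ^ 2 / (4 * t))

/-- Rotation by 90 degrees: `z^⊥ = (−z₂, z₁)`. -/
def perp (z : E2) : E2 := (EuclideanSpace.equiv (Fin 2) ℝ).symm ![-(z 1), z 0]

/-- The Biot–Savart velocity of a scalar vorticity on `ℝ²`:
`v(x) = (1/2π) ∫ (x−y)^⊥ / |x−y|² · ω(y) dy`. -/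
def biotSavart (ω : E2 → ℝ) (x : E2) : E2 :=
  (2 * π)⁻¹ • ∫ y : E2, (ω y / ‖x - y‖ ^ 2) • perp (x - y)

/-- Membership in `W^{1,1}(ℝ²)` (strong form). -/
def MemW11 (f : E2 → ℝ) : Prop :=
  Integrable f volume ∧ Differentiable ℝ f ∧ Integrable (fun x => gradient f x) volume

/-- The `W^{1,1}(ℝ²)` norm `‖f‖_{L¹} + ‖∇f‖_{L¹}`, valued in `ℝ≥0∞`. -/
def W11 (f : E2 → ℝ) : ℝ≥0∞ :=
  eLpNorm f 1 volume + eLpNorm (fun x => gradient f x) 1 volume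

/-- `ω` is a mild (Duhamel) solution of the 2D vorticity equation on `(0, t₀]`
with initial vorticity `ω₀`. -/
def IsMildSolution (ω₀ : E2 → ℝ) (t₀ : ℝ) (ω : ℝ → E2 → ℝ) : Prop :=
  ∀ t ∈ Set.Ioc (0 : ℝ) t₀, ∀ x : E2,
    ω t x = (∫ y : E2, K t (x - y) * ω₀ y) +
      ∫ s in Set.Ioc (0 : ℝ) t,
        ∫ y : E2, ⟪gradient (K (t - s)) (x - y), ω s y • biotSavart (ω s) y⟫

/-! ### Differentiable functions with integrable gradient -/

lemma measurable_gradient {f : E2 → ℝ} : Measurable (gradient f) :=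
  ((InnerProductSpace.toDual ℝ E2).symm.continuous.measurable).comp (measurable_fderiv ℝ f)

lemma hasDerivAt_comp_line {f : E2 → ℝ} (hf : Differentiable ℝ f) (x h : E2) (θ : ℝ) :
    HasDerivAt (fun θ : ℝ => f (x + θ • h)) ⟪gradient f (x + θ • h), h⟫ θ := by
  have h1 := (hf (x + θ • h)).hasGradientAt.hasFDerivAt
  have h2 : HasDerivAt (fun θ : ℝ => x + θ • h) h θ := by
    simpa using ((hasDerivAt_id θ).smul_const h).const_add x
  have h3 := h1.comp_hasDerivAt θ h2
  rwa [InnerProductSpace.toDual_apply_apply] at h3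

lemma measurable_inner_gradient_line {f : E2 → ℝ} (x h : E2) :
    Measurable (fun θ : ℝ => ⟪gradient f (x + θ • h), h⟫) :=
  ((measurable_gradient (f := f)).comp (by fun_prop)).inner_const

lemma enorm_inner_le (a b : E2) : ‖⟪a, b⟫‖ₑ ≤ ‖a‖ₑ * ‖b‖ₑ := by
  rw [← ofReal_norm, ← ofReal_norm, ← ofReal_norm, ← ENNReal.ofReal_mul (norm_nonneg _)]
  exact ENNReal.ofReal_le_ofReal (norm_inner_le_norm a b)

lemma enorm_sub_le_lintegral_gradient {f : E2 → ℝ} (hf : Differentiable ℝ f) (x h : E2) :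
    ‖f (x + h) - f x‖ₑ ≤ ∫⁻ θ in Set.Ioc (0 : ℝ) 1, ‖gradient f (x + θ • h)‖ₑ * ‖h‖ₑ := by
  have hle : ∫⁻ θ in Set.Ioc (0 : ℝ) 1, ‖⟪gradient f (x + θ • h), h⟫‖ₑ ≤
      ∫⁻ θ in Set.Ioc (0 : ℝ) 1, ‖gradient f (x + θ • h)‖ₑ * ‖h‖ₑ :=
    lintegral_mono fun θ => enorm_inner_le _ _
  rcases eq_or_ne (∫⁻ θ in Set.Ioc (0 : ℝ) 1, ‖⟪gradient f (x + θ • h), h⟫‖ₑ) ∞ with hi | hi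
  · rw [hi] at hle
    exact le_top.trans hle
  have hint : IntervalIntegrable (fun θ : ℝ => ⟪gradient f (x + θ • h), h⟫) volume 0 1 := by
    rw [intervalIntegrable_iff_integrableOn_Ioc_of_le zero_le_one]
    exact ⟨(measurable_inner_gradient_line x h).aestronglyMeasurable, hi.lt_top⟩
  have key := intervalIntegral.integral_eq_sub_of_hasDerivAt
    (fun θ _ => hasDerivAt_comp_line hf x h θ) hint
  simp only [one_smul, zero_smul, add_zero] at key
  rw [← key, intervalIntegral.integral_of_le zero_le_one]
  exact (enorm_integral_le_lintegral_enorm _).trans hle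

/-- Translations are Lipschitz in `L¹` on functions with integrable gradient. -/
lemma lintegral_enorm_translate_sub_le {f : E2 → ℝ} (hf : Differentiable ℝ f) (h : E2) :
    ∫⁻ x, ‖f (x + h) - f x‖ₑ ≤ ‖h‖ₑ * ∫⁻ x, ‖gradient f x‖ₑ := by
  have hm : Measurable (fun p : E2 × ℝ => ‖gradient f (p.1 + p.2 • h)‖ₑ * ‖h‖ₑ) :=
    (((measurable_gradient (f := f)).comp (by fun_prop)).enorm).mul_const _
  calc ∫⁻ x, ‖f (x + h) - f x‖ₑ
      ≤ ∫⁻ x, ∫⁻ θ in Set.Ioc (0 : ℝ) 1, ‖gradient f (x + θ • h)‖ₑ * ‖h‖ₑ :=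
        lintegral_mono fun x => enorm_sub_le_lintegral_gradient hf x h
    _ = ∫⁻ θ in Set.Ioc (0 : ℝ) 1, ∫⁻ x, ‖gradient f (x + θ • h)‖ₑ * ‖h‖ₑ :=
        lintegral_lintegral_swap hm.aemeasurable
    _ = ∫⁻ θ in Set.Ioc (0 : ℝ) 1, ‖h‖ₑ * ∫⁻ x, ‖gradient f x‖ₑ := by
        refine lintegral_congr fun θ => ?_
        rw [lintegral_add_right_eq_self (fun x => ‖gradient f x‖ₑ * ‖h‖ₑ) (θ • h),
          lintegral_mul_const _ measurable_gradient.enorm, mul_comm]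
    _ = ‖h‖ₑ * ∫⁻ x, ‖gradient f x‖ₑ := by simp

lemma lintegral_comp_smul_E2 (F : E2 → ℝ≥0∞) (hF : Measurable F) {r : ℝ} (hr : 0 < r) :
    ∫⁻ x, F (r • x) = ENNReal.ofReal (r ^ (-2 : ℝ)) * ∫⁻ x, F x := by
  rw [← lintegral_map hF (by fun_prop : Measurable fun x : E2 => r • x),
    Measure.map_addHaar_smul volume hr.ne', lintegral_smul_measure]
  simp [abs_of_pos hr, Real.rpow_neg hr.le]

lemma lintegral_lintegral_Ioi_comp_smul (F : E2 → ℝ≥0∞) (hF : Measurable F) :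
    ∫⁻ x, ∫⁻ r in Set.Ioi (1 : ℝ), F (r • x) = ∫⁻ x, F x := by
  have hm : Measurable (fun p : E2 × ℝ => F (p.2 • p.1)) := hF.comp (by fun_prop)
  rw [lintegral_lintegral_swap hm.aemeasurable,
    setLIntegral_congr_fun measurableSet_Ioi
      (fun r hr => lintegral_comp_smul_E2 F hF (zero_lt_one.trans hr)),
    lintegral_mul_const _ (by fun_prop),
    ← ofReal_integral_eq_lintegral_ofReal
      (integrableOn_Ioi_rpow_of_lt (by norm_num) one_pos)
      ((ae_restrict_iff' measurableSet_Ioi).2 (ae_of_all _ fun r hr =>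
        Real.rpow_nonneg (zero_le_one.trans (le_of_lt hr)) _)),
    integral_Ioi_rpow_of_lt (by norm_num) one_pos]
  norm_num

lemma lintegral_enorm_mul_inv_enorm_le {f : E2 → ℝ} (hf : Differentiable ℝ f)
    (hfi : Integrable f) :
    ∫⁻ x, ‖f x‖ₑ * ‖x‖ₑ⁻¹ ≤ ∫⁻ x, ‖gradient f x‖ₑ := by
  rw [← lintegral_lintegral_Ioi_comp_smul _ (measurable_gradient (f := f)).enorm]
  have hfm : Measurable f := hf.continuous.measurable
  have hfin : ∫⁻ x, ∫⁻ r in Set.Ioi (1 : ℝ), ‖f (r • x)‖ₑ ≠ ∞ := by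
    rw [lintegral_lintegral_Ioi_comp_smul _ hfm.enorm]
    exact hfi.2.ne
  have hae := ae_lt_top' (Measurable.lintegral_prod_right'
    (f := fun p : E2 × ℝ => ‖f (p.2 • p.1)‖ₑ)
    (hfm.enorm.comp (by fun_prop))).aemeasurable hfin
  refine lintegral_mono_ae ?_
  filter_upwards [hae, Measure.ae_ne volume (0 : E2)] with x hx hx0
  have hx0' : ‖x‖ₑ ≠ 0 := by simpa using hx0
  rw [← div_eq_mul_inv, ENNReal.div_le_iff hx0' (by simp)]
  have hgm : Measurable (fun r : ℝ => ‖gradient f (r • x)‖ₑ) :=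
    ((measurable_gradient (f := f)).comp (by fun_prop)).enorm
  rw [← lintegral_mul_const _ hgm]
  have hle : ∫⁻ r in Set.Ioi (1 : ℝ), ‖⟪gradient f ((0 : E2) + r • x), x⟫‖ₑ ≤
      ∫⁻ r in Set.Ioi (1 : ℝ), ‖gradient f (r • x)‖ₑ * ‖x‖ₑ :=
    lintegral_mono fun θ => by simpa using enorm_inner_le (gradient f (θ • x)) x
  rcases eq_or_ne (∫⁻ r in Set.Ioi (1 : ℝ), ‖⟪gradient f ((0 : E2) + r • x), x⟫‖ₑ) ∞ with hi | hi
  · rw [hi] at hle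
    exact le_top.trans hle
  have hint : IntegrableOn (fun r : ℝ => ⟪gradient f ((0 : E2) + r • x), x⟫) (Set.Ioi 1) :=
    ⟨(measurable_inner_gradient_line 0 x).aestronglyMeasurable, hi.lt_top⟩
  have hint' : IntegrableOn (fun r : ℝ => f ((0 : E2) + r • x)) (Set.Ioi 1) :=
    ⟨(hfm.comp (by fun_prop)).aestronglyMeasurable, by simpa [HasFiniteIntegral] using hx⟩
  have hder := fun r : ℝ => hasDerivAt_comp_line hf 0 x r
  have htend := tendsto_zero_of_hasDerivAt_of_integrableOn_Ioi (a := 1)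
    (fun r _ => hder r) hint hint'
  have key := integral_Ioi_of_hasDerivAt_of_tendsto' (a := 1) (fun r _ => hder r) hint htend
  have hfx : ‖f x‖ₑ = ‖∫ r in Set.Ioi (1 : ℝ), ⟪gradient f ((0 : E2) + r • x), x⟫‖ₑ := by
    rw [key]; simp
  rw [hfx]
  exact (enorm_integral_le_lintegral_enorm _).trans hle

lemma gradient_comp_add_right (f : E2 → ℝ) (a x : E2) :
    gradient (fun y => f (y + a)) x = gradient f (x + a) := by
  simp only [gradient, fderiv_comp_add_right]

/-- Hardy's inequality in `W^{1,1}(ℝ²)`. -/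
lemma lintegral_enorm_mul_inv_enorm_sub_le {f : E2 → ℝ} (hf : MemW11 f) (a : E2) :
    ∫⁻ x, ‖f x‖ₑ * ‖a - x‖ₑ⁻¹ ≤ ∫⁻ x, ‖gradient f x‖ₑ := by
  have h := lintegral_enorm_mul_inv_enorm_le (f := fun y => f (y + a))
    (hf.2.1.comp (differentiable_id.add_const a)) (hf.1.comp_add_right a)
  simp only [gradient_comp_add_right] at h
  rw [lintegral_add_right_eq_self (fun x => ‖gradient f x‖ₑ) a] at h
  rw [← lintegral_add_right_eq_self _ a]
  refine le_trans (le_of_eq ?_) h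
  refine lintegral_congr fun x => ?_
  rw [← enorm_neg (a - (x + a))]
  congr 3
  abel

/-! ### The Biot–Savart velocity and the nonlinearity -/

lemma MemW11.gradient_sub {f g : E2 → ℝ} (hf : MemW11 f) (hg : MemW11 g) :
    (fun x => gradient (fun x => f x - g x) x) = fun x => gradient f x - gradient g x := by
  funext x
  simp only [gradient]
  rw [fderiv_fun_sub (hf.2.1 x) (hg.2.1 x), map_sub]

lemma MemW11.sub {f g : E2 → ℝ} (hf : MemW11 f) (hg : MemW11 g) :
    MemW11 (fun x => f x - g x) := by
  refine ⟨hf.1.sub hg.1, hf.2.1.sub hg.2.1, ?_⟩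
  rw [hf.gradient_sub hg]
  exact hf.2.2.sub hg.2.2

lemma MemW11.W11_sub_le {f g : E2 → ℝ} (hf : MemW11 f) (hg : MemW11 g) :
    W11 (fun x => f x - g x) ≤ W11 f + W11 g := by
  rw [W11, hf.gradient_sub hg]
  refine (add_le_add (eLpNorm_sub_le hf.1.1 hg.1.1 le_rfl)
    (eLpNorm_sub_le hf.2.2.1 hg.2.2.1 le_rfl)).trans_eq ?_
  simp only [W11]
  ring

lemma MemW11.comp_add_right {f : E2 → ℝ} (hf : MemW11 f) (a : E2) :
    MemW11 (fun x => f (x + a)) := by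
  refine ⟨hf.1.comp_add_right a, hf.2.1.comp (differentiable_id.add_const a), ?_⟩
  simpa only [gradient_comp_add_right] using hf.2.2.comp_add_right a

lemma MemW11.measurable {f : E2 → ℝ} (hf : MemW11 f) : Measurable f :=
  hf.2.1.continuous.measurable

lemma lintegral_enorm_le_W11 (f : E2 → ℝ) : ∫⁻ x, ‖f x‖ₑ ≤ W11 f := by
  rw [W11, eLpNorm_one_eq_lintegral_enorm]
  exact le_self_add

lemma lintegral_enorm_gradient_le_W11 (f : E2 → ℝ) : ∫⁻ x, ‖gradient f x‖ₑ ≤ W11 f := by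
  rw [W11, eLpNorm_one_eq_lintegral_enorm, eLpNorm_one_eq_lintegral_enorm]
  exact le_add_self

lemma norm_perp (z : E2) : ‖perp z‖ = ‖z‖ := by
  simp [perp, EuclideanSpace.norm_eq, add_comm]

lemma measurable_perp : Measurable perp := by
  apply Continuous.measurable
  unfold perp
  refine (EuclideanSpace.equiv (Fin 2) ℝ).symm.continuous.comp ?_
  refine continuous_pi fun i => ?_
  fin_cases i
  · simp; fun_prop
  · simp; fun_prop

lemma enorm_biotSavart_integrand_le (g : E2 → ℝ) (x y : E2) :
    ‖(g y / ‖x - y‖ ^ 2) • perp (x - y)‖ₑ ≤ ‖g y‖ₑ * ‖x - y‖ₑ⁻¹ := by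
  rcases eq_or_ne (x - y) 0 with h | h
  · have : perp (0 : E2) = 0 := by simpa using norm_perp 0
    simp [h, this]
  · have hz : ‖x - y‖ ≠ 0 := by simpa using h
    refine le_of_eq ?_
    rw [← enorm_norm (x - y), ← enorm_inv hz, ← enorm_mul, enorm_eq_iff_norm_eq, norm_smul,
      norm_perp, norm_div, norm_mul, norm_inv, norm_pow, norm_norm]
    field_simp

lemma enorm_biotSavart_le (g : E2 → ℝ) (x : E2) :
    ‖biotSavart g x‖ₑ ≤ ∫⁻ y, ‖g y‖ₑ * ‖x - y‖ₑ⁻¹ := by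
  have h1 : ‖(2 * π)⁻¹‖ₑ ≤ 1 := by
    rw [← ofReal_norm, ENNReal.ofReal_le_one, Real.norm_of_nonneg (by positivity)]
    refine inv_le_one_of_one_le₀ ?_
    linarith [Real.pi_gt_three]
  rw [biotSavart, enorm_smul]
  calc _ ≤ 1 * ∫⁻ y, ‖(g y / ‖x - y‖ ^ 2) • perp (x - y)‖ₑ :=
        mul_le_mul' h1 (enorm_integral_le_lintegral_enorm _)
    _ ≤ _ := by
        rw [one_mul]
        exact lintegral_mono fun y => enorm_biotSavart_integrand_le g x y

lemma enorm_biotSavart_le_gradient {g : E2 → ℝ} (hg : MemW11 g) (x : E2) :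
    ‖biotSavart g x‖ₑ ≤ ∫⁻ y, ‖gradient g y‖ₑ :=
  (enorm_biotSavart_le g x).trans (lintegral_enorm_mul_inv_enorm_sub_le hg x)

lemma integrable_biotSavart_integrand {g : E2 → ℝ} (hg : MemW11 g) (x : E2) :
    Integrable (fun y => (g y / ‖x - y‖ ^ 2) • perp (x - y)) := by
  have hm := hg.measurable
  refine ⟨((hm.div (by fun_prop)).smul
    (measurable_perp.comp (by fun_prop))).aestronglyMeasurable, ?_⟩
  refine lt_of_le_of_lt (lintegral_mono fun y => enorm_biotSavart_integrand_le g x y) ?_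
  exact (lintegral_enorm_mul_inv_enorm_sub_le hg x).trans_lt hg.2.2.2

lemma biotSavart_sub {f g : E2 → ℝ} (hf : MemW11 f) (hg : MemW11 g) (x : E2) :
    biotSavart (fun y => f y - g y) x = biotSavart f x - biotSavart g x := by
  simp only [biotSavart, sub_div, sub_smul]
  rw [integral_sub (integrable_biotSavart_integrand hf x) (integrable_biotSavart_integrand hg x),
    smul_sub]

lemma biotSavart_comp_add_right (g : E2 → ℝ) (h x : E2) :
    biotSavart (fun y => g (y + h)) x = biotSavart g (x + h) := by
  simp only [biotSavart]
  rw [← integral_add_right_eq_self (fun y => (g y / ‖x + h - y‖ ^ 2) • perp (x + h - y)) h]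
  simp

lemma measurable_biotSavart_uncurry {S : Type*} [MeasurableSpace S] {g : S → E2 → ℝ}
    (hg : Measurable (Function.uncurry g)) :
    Measurable (fun p : S × E2 => biotSavart (g p.1) p.2) := by
  unfold biotSavart
  refine Measurable.const_smul (M := ℝ) ?_ _
  refine StronglyMeasurable.measurable ?_
  refine StronglyMeasurable.integral_prod_right'
    (f := fun q : (S × E2) × E2 => (g q.1.1 q.2 / ‖q.1.2 - q.2‖ ^ 2) • perp (q.1.2 - q.2)) ?_
  refine Measurable.stronglyMeasurable ?_
  refine Measurable.smul (Measurable.div (hg.comp (f := fun q : (S × E2) × E2 => (q.1.1, q.2))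
    (by fun_prop)) (by fun_prop)) (measurable_perp.comp (by fun_prop))

lemma measurable_biotSavart {g : E2 → ℝ} (hg : Measurable g) : Measurable (biotSavart g) :=
  (measurable_biotSavart_uncurry (S := Unit) (g := fun _ => g)
    (hg.comp measurable_snd)).comp (f := fun x : E2 => ((), x)) (by fun_prop)

/-- The bilinear nonlinearity `f v[g]`. -/
def vortFlux (f g : E2 → ℝ) (x : E2) : E2 := f x • biotSavart g x

lemma measurable_vortFlux {f g : E2 → ℝ} (hf : Measurable f) (hg : Measurable g) :
    Measurable (vortFlux f g) := hf.smul (measurable_biotSavart hg)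

lemma lintegral_enorm_vortFlux_le {f g : E2 → ℝ} (hf : Measurable f) (hg : MemW11 g) :
    ∫⁻ x, ‖vortFlux f g x‖ₑ ≤ (∫⁻ x, ‖f x‖ₑ) * ∫⁻ x, ‖gradient g x‖ₑ := by
  rw [← lintegral_mul_const _ hf.enorm]
  refine lintegral_mono fun x => ?_
  rw [vortFlux, enorm_smul]
  exact mul_le_mul' le_rfl (enorm_biotSavart_le_gradient hg x)

lemma lintegral_enorm_vortFlux_le' {f g : E2 → ℝ} (hf : MemW11 f) (hg : Measurable g) :
    ∫⁻ x, ‖vortFlux f g x‖ₑ ≤ (∫⁻ x, ‖gradient f x‖ₑ) * ∫⁻ x, ‖g x‖ₑ := by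
  have hfm := hf.measurable
  have hm : Measurable (fun p : E2 × E2 => ‖g p.2‖ₑ * (‖f p.1‖ₑ * ‖p.1 - p.2‖ₑ⁻¹)) := by fun_prop
  calc ∫⁻ x, ‖vortFlux f g x‖ₑ ≤ ∫⁻ x, ∫⁻ y, ‖g y‖ₑ * (‖f x‖ₑ * ‖x - y‖ₑ⁻¹) := by
        refine lintegral_mono fun x => ?_
        rw [vortFlux, enorm_smul]
        refine (mul_le_mul' le_rfl (enorm_biotSavart_le g x)).trans (le_of_eq ?_)
        rw [← lintegral_const_mul _ (by fun_prop)]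
        exact lintegral_congr fun y => by ring
    _ = ∫⁻ y, ∫⁻ x, ‖g y‖ₑ * (‖f x‖ₑ * ‖x - y‖ₑ⁻¹) := lintegral_lintegral_swap hm.aemeasurable
    _ ≤ ∫⁻ y, ‖g y‖ₑ * ∫⁻ x, ‖gradient f x‖ₑ := by
        refine lintegral_mono fun y => ?_
        rw [lintegral_const_mul _ (by fun_prop)]
        refine mul_le_mul' le_rfl ?_
        simpa only [← enorm_neg (y - _), neg_sub] using lintegral_enorm_mul_inv_enorm_sub_le hf y
    _ = _ := by rw [lintegral_mul_const _ hg.enorm, mul_comm]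

lemma lintegral_enorm_translate_vortFlux_sub_le {f g : E2 → ℝ} (hf : MemW11 f) (hg : MemW11 g)
    (h : E2) :
    ∫⁻ x, ‖vortFlux f g (x + h) - vortFlux f g x‖ₑ ≤
      2 * ‖h‖ₑ * ((∫⁻ x, ‖gradient f x‖ₑ) * ∫⁻ x, ‖gradient g x‖ₑ) := by
  have hgh := hg.comp_add_right h
  have hfh := hf.comp_add_right h
  have hfm := (hfh.sub hf).measurable
  have hgm := (hgh.sub hg).measurable
  have hsplit : ∀ x, vortFlux f g (x + h) - vortFlux f g x =
      vortFlux (fun x => f (x + h) - f x) (fun x => g (x + h)) x +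
      vortFlux f (fun x => g (x + h) - g x) x := by
    intro x
    simp only [vortFlux, biotSavart_sub hgh hg, biotSavart_comp_add_right, sub_smul, smul_sub]
    abel
  calc ∫⁻ x, ‖vortFlux f g (x + h) - vortFlux f g x‖ₑ
      ≤ ∫⁻ x, (‖vortFlux (fun x => f (x + h) - f x) (fun x => g (x + h)) x‖ₑ +
          ‖vortFlux f (fun x => g (x + h) - g x) x‖ₑ) := by
        refine lintegral_mono fun x => ?_
        rw [hsplit]
        exact enorm_add_le _ _
    _ ≤ (∫⁻ x, ‖f (x + h) - f x‖ₑ) * (∫⁻ x, ‖gradient (fun x => g (x + h)) x‖ₑ) +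
          (∫⁻ x, ‖gradient f x‖ₑ) * ∫⁻ x, ‖g (x + h) - g x‖ₑ := by
        rw [lintegral_add_left (measurable_vortFlux hfm hgh.measurable).enorm]
        exact add_le_add (lintegral_enorm_vortFlux_le hfm hgh)
          (lintegral_enorm_vortFlux_le' hf hgm)
    _ ≤ (‖h‖ₑ * ∫⁻ x, ‖gradient f x‖ₑ) * (∫⁻ x, ‖gradient g x‖ₑ) +
          (∫⁻ x, ‖gradient f x‖ₑ) * (‖h‖ₑ * ∫⁻ x, ‖gradient g x‖ₑ) := by
        simp only [gradient_comp_add_right]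
        rw [lintegral_add_right_eq_self (fun x => ‖gradient g x‖ₑ) h]
        exact add_le_add (mul_le_mul' (lintegral_enorm_translate_sub_le hf.2.1 h) le_rfl)
          (mul_le_mul' le_rfl (lintegral_enorm_translate_sub_le hg.2.1 h))
    _ = _ := by ring

lemma vortFlux_self_sub {f g : E2 → ℝ} (hf : MemW11 f) (hg : MemW11 g) (x : E2) :
    vortFlux f f x - vortFlux g g x =
      vortFlux (fun x => f x - g x) f x + vortFlux g (fun x => f x - g x) x := by
  simp only [vortFlux, biotSavart_sub hf hg, sub_smul, smul_sub]
  abel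

lemma integrable_vortFlux {f g : E2 → ℝ} (hf : MemW11 f) (hg : MemW11 g) :
    Integrable (vortFlux f g) :=
  ⟨(measurable_vortFlux hf.measurable hg.measurable).aestronglyMeasurable,
    (lintegral_enorm_vortFlux_le hf.measurable hg).trans_lt (ENNReal.mul_lt_top hf.1.2 hg.2.2.2)⟩

lemma lintegral_enorm_vortFlux_self_sub_le {f g : E2 → ℝ} (hf : MemW11 f) (hg : MemW11 g) :
    ∫⁻ x, ‖vortFlux f f x - vortFlux g g x‖ₑ ≤
      W11 (fun x => f x - g x) * (W11 f + W11 g) := by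
  have hd := hf.sub hg
  calc ∫⁻ x, ‖vortFlux f f x - vortFlux g g x‖ₑ
      ≤ ∫⁻ x, (‖vortFlux (fun x => f x - g x) f x‖ₑ +
          ‖vortFlux g (fun x => f x - g x) x‖ₑ) := by
        refine lintegral_mono fun x => ?_
        rw [vortFlux_self_sub hf hg]
        exact enorm_add_le _ _
    _ ≤ W11 (fun x => f x - g x) * W11 f + W11 g * W11 (fun x => f x - g x) := by
        rw [lintegral_add_left (measurable_vortFlux hd.measurable hf.measurable).enorm]
        refine add_le_add ((lintegral_enorm_vortFlux_le hd.measurable hf).trans ?_)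
          ((lintegral_enorm_vortFlux_le hg.measurable hd).trans ?_)
        · exact mul_le_mul' (lintegral_enorm_le_W11 _) (lintegral_enorm_gradient_le_W11 _)
        · exact mul_le_mul' (lintegral_enorm_le_W11 _) (lintegral_enorm_gradient_le_W11 _)
    _ = _ := by ring

lemma lintegral_enorm_translate_vortFlux_self_sub_le {f g : E2 → ℝ} (hf : MemW11 f)
    (hg : MemW11 g) (h : E2) :
    ∫⁻ x, ‖(vortFlux f f (x + h) - vortFlux g g (x + h)) -
        (vortFlux f f x - vortFlux g g x)‖ₑ ≤
      2 * ‖h‖ₑ * (W11 (fun x => f x - g x) * (W11 f + W11 g)) := by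
  have hd := hf.sub hg
  have hm := measurable_vortFlux hd.measurable hf.measurable
  have hm' : Measurable (fun x => ‖vortFlux (fun x => f x - g x) f (x + h) -
      vortFlux (fun x => f x - g x) f x‖ₑ) := ((hm.comp (measurable_add_const h)).sub hm).enorm
  calc _ ≤ ∫⁻ x, (‖vortFlux (fun x => f x - g x) f (x + h) -
            vortFlux (fun x => f x - g x) f x‖ₑ +
          ‖vortFlux g (fun x => f x - g x) (x + h) - vortFlux g (fun x => f x - g x) x‖ₑ) := by
        refine lintegral_mono fun x => ?_
        rw [vortFlux_self_sub hf hg, vortFlux_self_sub hf hg, add_sub_add_comm]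
        exact enorm_add_le _ _
    _ ≤ 2 * ‖h‖ₑ * (W11 (fun x => f x - g x) * W11 f) +
          2 * ‖h‖ₑ * (W11 g * W11 (fun x => f x - g x)) := by
        rw [lintegral_add_left hm']
        refine add_le_add ((lintegral_enorm_translate_vortFlux_sub_le hd hf h).trans ?_)
          ((lintegral_enorm_translate_vortFlux_sub_le hg hd h).trans ?_)
        · exact mul_le_mul' le_rfl (mul_le_mul' (lintegral_enorm_gradient_le_W11 _)
            (lintegral_enorm_gradient_le_W11 _))
        · exact mul_le_mul' le_rfl (mul_le_mul' (lintegral_enorm_gradient_le_W11 _)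
            (lintegral_enorm_gradient_le_W11 _))
    _ = _ := by ring

/-! ### The heat kernel -/

lemma gradient_K (τ : ℝ) (x : E2) : gradient (K τ) x = (-(2 * τ)⁻¹ * K τ x) • x := by
  have h1 : HasFDerivAt (fun x : E2 => -‖x‖ ^ 2 / (4 * τ))
      ((4 * τ)⁻¹ • (-((2 : ℕ) • (innerSL ℝ x)) : E2 →L[ℝ] ℝ)) x := by
    have := ((hasStrictFDerivAt_norm_sq x).hasFDerivAt.neg).const_mul ((4 * τ)⁻¹)
    refine this.congr_of_eventuallyEq (Eventually.of_forall fun y => ?_)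
    simp only [div_eq_inv_mul]
    rfl
  have h2 := (h1.exp.const_mul ((4 * π * τ)⁻¹)).hasGradientAt.gradient
  change gradient (fun x => (4 * π * τ)⁻¹ * Real.exp (-‖x‖ ^ 2 / (4 * τ))) x = _
  rw [h2, LinearIsometryEquiv.symm_apply_eq]
  ext y
  simp [K]
  rcases eq_or_ne τ 0 with h | h
  · simp [h]
  · field_simp
    ring

lemma measurable_K_uncurry : Measurable (fun p : ℝ × E2 => K p.1 p.2) := by
  unfold K
  fun_prop

lemma measurable_gradient_K_uncurry : Measurable (fun p : ℝ × E2 => gradient (K p.1) p.2) := by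
  simp only [gradient_K]
  have := measurable_K_uncurry
  fun_prop

lemma continuous_K (τ : ℝ) : Continuous (K τ) := by
  unfold K
  fun_prop

lemma continuous_gradient_K (τ : ℝ) : Continuous (fun x => gradient (K τ) x) := by
  simp only [gradient_K]
  have := continuous_K τ
  fun_prop

lemma K_nonneg {τ : ℝ} (hτ : 0 < τ) (x : E2) : 0 ≤ K τ x := by
  unfold K
  positivity

lemma K_le {τ : ℝ} (hτ : 0 < τ) (x : E2) : K τ x ≤ (4 * π * τ)⁻¹ := by
  unfold K
  refine mul_le_of_le_one_right (by positivity) (Real.exp_le_one_iff.2 ?_)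
  rw [neg_div]
  exact neg_nonpos.2 (by positivity)

lemma integral_K {τ : ℝ} (hτ : 0 < τ) : ∫ x, K τ x = 1 := by
  have h := GaussianFourier.integral_rexp_neg_mul_sq_norm (V := E2) (b := (4 * τ)⁻¹) (by positivity)
  simp only [K]
  rw [integral_const_mul]
  have h' : (fun x : E2 => Real.exp (-‖x‖ ^ 2 / (4 * τ))) =
      fun x => Real.exp (-(4 * τ)⁻¹ * ‖x‖ ^ 2) := by
    funext x
    congr 1
    ring
  rw [h', h]
  simp
  field_simp

lemma lintegral_enorm_K {τ : ℝ} (hτ : 0 < τ) : ∫⁻ x, ‖K τ x‖ₑ = 1 := by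
  have hi : Integrable (K τ) := by
    by_contra h
    have := integral_K hτ
    rw [integral_undef h] at this
    exact zero_ne_one this
  have := ofReal_integral_eq_lintegral_ofReal hi (ae_of_all _ (K_nonneg hτ))
  rw [integral_K hτ, ENNReal.ofReal_one] at this
  rw [this]
  exact lintegral_congr fun x => Real.enorm_of_nonneg (K_nonneg hτ x)

lemma norm_gradient_K_le {τ : ℝ} (hτ : 0 < τ) (x : E2) :
    ‖gradient (K τ) x‖ ≤ 2 * τ ^ (-(1 / 2) : ℝ) * K (2 * τ) x := by
  rw [gradient_K, norm_smul, norm_mul, norm_neg, Real.norm_of_nonneg (K_nonneg hτ x),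
    Real.norm_of_nonneg (by positivity)]
  obtain ⟨σ, hσ, rfl⟩ : ∃ σ : ℝ, 0 < σ ∧ τ = σ ^ 2 :=
    ⟨√τ, Real.sqrt_pos.2 hτ, (Real.sq_sqrt hτ.le).symm⟩
  have hr : (σ ^ 2 : ℝ) ^ (-(1 / 2) : ℝ) = σ⁻¹ := by
    rw [Real.rpow_neg (by positivity), ← Real.sqrt_eq_rpow, Real.sqrt_sq hσ.le]
  rw [hr]
  simp only [K]
  set u : ℝ := ‖x‖ / (2 * σ) with hu
  have hx : ‖x‖ = 2 * σ * u := by rw [hu]; field_simp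
  have hu0 : 0 ≤ u := by positivity
  have e1 : -‖x‖ ^ 2 / (4 * σ ^ 2) = -(u ^ 2 / 2) + -(u ^ 2 / 2) := by
    rw [hx]; field_simp; ring
  have e2 : -‖x‖ ^ 2 / (4 * (2 * σ ^ 2)) = -(u ^ 2 / 2) := by
    rw [hx]; field_simp; ring
  rw [e1, e2, Real.exp_add, hx]
  have hexp : u * Real.exp (-(u ^ 2 / 2)) ≤ 1 := by
    rw [Real.exp_neg, ← div_eq_mul_inv, div_le_one (Real.exp_pos _)]
    nlinarith [Real.add_one_le_exp (u ^ 2 / 2), sq_nonneg (u - 1)]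
  have hE := Real.exp_pos (-(u ^ 2 / 2))
  calc _ = (4 * π * σ ^ 2)⁻¹ * σ⁻¹ * Real.exp (-(u ^ 2 / 2)) *
        (u * Real.exp (-(u ^ 2 / 2))) := by
        field_simp
    _ ≤ (4 * π * σ ^ 2)⁻¹ * σ⁻¹ * Real.exp (-(u ^ 2 / 2)) * 1 := by gcongr
    _ = _ := by
        field_simp
        try ring

lemma norm_gradient_K_le' {τ : ℝ} (hτ : 0 < τ) (x : E2) :
    ‖gradient (K τ) x‖ ≤ 2 * τ ^ (-(1 / 2) : ℝ) * (4 * π * (2 * τ))⁻¹ :=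
  (norm_gradient_K_le hτ x).trans
    (mul_le_mul_of_nonneg_left (K_le (by positivity) x) (by positivity))

lemma lintegral_enorm_gradient_K_le {τ : ℝ} (hτ : 0 < τ) :
    ∫⁻ x, ‖gradient (K τ) x‖ₑ ≤ ENNReal.ofReal (2 * τ ^ (-(1 / 2) : ℝ)) := by
  calc ∫⁻ x, ‖gradient (K τ) x‖ₑ
      ≤ ∫⁻ x, ENNReal.ofReal (2 * τ ^ (-(1 / 2) : ℝ)) * ‖K (2 * τ) x‖ₑ := by
        refine lintegral_mono fun x => ?_
        rw [← ofReal_norm, ← ofReal_norm, ← ENNReal.ofReal_mul (by positivity)]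
        rw [Real.norm_of_nonneg (K_nonneg (by positivity) x)]
        exact ENNReal.ofReal_le_ofReal (norm_gradient_K_le hτ x)
    _ = _ := by
        rw [lintegral_const_mul _ (continuous_K _).measurable.enorm,
          lintegral_enorm_K (by positivity), mul_one]

lemma integrable_gradient_K {τ : ℝ} (hτ : 0 < τ) : Integrable (fun x => gradient (K τ) x) :=
  ⟨(continuous_gradient_K τ).aestronglyMeasurable,
    (lintegral_enorm_gradient_K_le hτ).trans_lt ENNReal.ofReal_lt_top⟩

/-! ### Heat semigroup and its divergence form -/

/-- The heat evolution of `f`. -/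
def heat (τ : ℝ) (f : E2 → ℝ) (x : E2) : ℝ := ∫ y, K τ (x - y) * f y

/-- The heat evolution of the divergence of `G`. -/
def heatDiv (τ : ℝ) (G : E2 → E2) (x : E2) : ℝ := ∫ y, ⟪gradient (K τ) (x - y), G y⟫

lemma integrable_heat_integrand {τ : ℝ} (hτ : 0 < τ) {f : E2 → ℝ} (hf : Integrable f) (x : E2) :
    Integrable (fun y => K τ (x - y) * f y) := by
  refine hf.bdd_mul (c := (4 * π * τ)⁻¹)
    ((continuous_K τ).comp (by fun_prop)).aestronglyMeasurable (ae_of_all _ fun y => ?_)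
  rw [Real.norm_of_nonneg (K_nonneg hτ _)]
  exact K_le hτ _

lemma norm_heatDiv_integrand_le {τ : ℝ} (hτ : 0 < τ) (G : E2 → E2) (x y : E2) :
    ‖⟪gradient (K τ) (x - y), G y⟫‖ ≤ 2 * τ ^ (-(1 / 2) : ℝ) * (4 * π * (2 * τ))⁻¹ * ‖G y‖ :=
  (norm_inner_le_norm _ _).trans
    (mul_le_mul_of_nonneg_right (norm_gradient_K_le' hτ _) (norm_nonneg _))

lemma aestronglyMeasurable_heatDiv_integrand (τ : ℝ) {G : E2 → E2} (hG : Integrable G) (x : E2) :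
    AEStronglyMeasurable (fun y => ⟪gradient (K τ) (x - y), G y⟫) volume :=
  AEStronglyMeasurable.inner
    ((continuous_gradient_K τ).comp (continuous_const.sub continuous_id)).aestronglyMeasurable hG.1

lemma integrable_heatDiv_integrand {τ : ℝ} (hτ : 0 < τ) {G : E2 → E2} (hG : Integrable G) (x : E2) :
    Integrable (fun y => ⟪gradient (K τ) (x - y), G y⟫) :=
  (hG.norm.const_mul (2 * τ ^ (-(1 / 2) : ℝ) * (4 * π * (2 * τ))⁻¹)).mono'
    (aestronglyMeasurable_heatDiv_integrand τ hG x)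
    (ae_of_all _ fun y => norm_heatDiv_integrand_le hτ G x y)

lemma continuous_heat {τ : ℝ} (hτ : 0 < τ) {f : E2 → ℝ} (hf : Integrable f) :
    Continuous (heat τ f) := by
  refine continuous_of_dominated (bound := fun y => (4 * π * τ)⁻¹ * ‖f y‖)
    (fun x => (integrable_heat_integrand hτ hf x).1) (fun x => ae_of_all _ fun y => ?_)
    (hf.norm.const_mul _) (ae_of_all _ fun y => ?_)
  · rw [norm_mul, Real.norm_of_nonneg (K_nonneg hτ _)]
    exact mul_le_mul_of_nonneg_right (K_le hτ _) (norm_nonneg _)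
  · exact ((continuous_K τ).comp (by fun_prop)).mul continuous_const

lemma continuous_heatDiv {τ : ℝ} (hτ : 0 < τ) {G : E2 → E2} (hG : Integrable G) :
    Continuous (heatDiv τ G) := by
  refine continuous_of_dominated
    (bound := fun y => 2 * τ ^ (-(1 / 2) : ℝ) * (4 * π * (2 * τ))⁻¹ * ‖G y‖)
    (fun x => aestronglyMeasurable_heatDiv_integrand τ hG x)
    (fun x => ae_of_all _ fun y => norm_heatDiv_integrand_le hτ G x y)
    (hG.norm.const_mul _) (ae_of_all _ fun y => ?_)
  exact ((continuous_gradient_K τ).comp (continuous_id.sub continuous_const)).inner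
    continuous_const

lemma heat_sub {τ : ℝ} (hτ : 0 < τ) {f g : E2 → ℝ} (hf : Integrable f) (hg : Integrable g)
    (x : E2) : heat τ (fun y => f y - g y) x = heat τ f x - heat τ g x := by
  simp only [heat, mul_sub]
  exact integral_sub (integrable_heat_integrand hτ hf x) (integrable_heat_integrand hτ hg x)

lemma heatDiv_sub {τ : ℝ} (hτ : 0 < τ) {F G : E2 → E2} (hF : Integrable F) (hG : Integrable G)
    (x : E2) : heatDiv τ (fun y => F y - G y) x = heatDiv τ F x - heatDiv τ G x := by
  simp only [heatDiv, inner_sub_right]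
  exact integral_sub (integrable_heatDiv_integrand hτ hF x) (integrable_heatDiv_integrand hτ hG x)

lemma heat_comp_add_right (τ : ℝ) (f : E2 → ℝ) (h x : E2) :
    heat τ (fun y => f (y + h)) x = heat τ f (x + h) := by
  simp only [heat]
  rw [← integral_add_right_eq_self (fun y => K τ (x + h - y) * f y) h]
  simp

lemma heatDiv_comp_add_right (τ : ℝ) (G : E2 → E2) (h x : E2) :
    heatDiv τ (fun y => G (y + h)) x = heatDiv τ G (x + h) := by
  simp only [heatDiv]
  rw [← integral_add_right_eq_self (fun y => ⟪gradient (K τ) (x + h - y), G y⟫) h]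
  simp

lemma lintegral_convolution_le {E F : Type*} [NormedAddCommGroup E] [NormedAddCommGroup F]
    {k : E2 → E} {f : E2 → F} (hk : Continuous k) (hf : AEStronglyMeasurable f volume) :
    ∫⁻ x, ∫⁻ y, ‖k (x - y)‖ₑ * ‖f y‖ₑ = (∫⁻ x, ‖k x‖ₑ) * ∫⁻ y, ‖f y‖ₑ := by
  have hm : AEMeasurable (fun p : E2 × E2 => ‖k (p.1 - p.2)‖ₑ * ‖f p.2‖ₑ)
      (volume.prod volume) := by
    refine AEMeasurable.mul (M := ℝ≥0∞) ?_ ?_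
    · exact (continuous_enorm.comp (hk.comp (by fun_prop))).measurable.aemeasurable
    · exact hf.comp_snd.enorm
  rw [lintegral_lintegral_swap hm]
  have h : ∀ y, ∫⁻ x, ‖k (x - y)‖ₑ * ‖f y‖ₑ = (∫⁻ x, ‖k x‖ₑ) * ‖f y‖ₑ := fun y => by
    have hk' : Measurable (fun x => ‖k (x - y)‖ₑ) :=
      (continuous_enorm.comp (hk.comp (by fun_prop))).measurable
    rw [lintegral_mul_const _ hk', lintegral_sub_right_eq_self (fun x => ‖k x‖ₑ) y]
  simp only [h]
  rw [lintegral_const_mul'' _ hf.enorm]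

lemma lintegral_enorm_heat_le {τ : ℝ} (hτ : 0 < τ) {f : E2 → ℝ} (hf : Integrable f) :
    ∫⁻ x, ‖heat τ f x‖ₑ ≤ ∫⁻ y, ‖f y‖ₑ := by
  calc ∫⁻ x, ‖heat τ f x‖ₑ ≤ ∫⁻ x, ∫⁻ y, ‖K τ (x - y)‖ₑ * ‖f y‖ₑ := by
        refine lintegral_mono fun x => (enorm_integral_le_lintegral_enorm _).trans ?_
        exact lintegral_mono fun y => (enorm_mul _ _).le
    _ = ∫⁻ y, ‖f y‖ₑ := by
        rw [lintegral_convolution_le (continuous_K τ) hf.1, lintegral_enorm_K hτ, one_mul]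

lemma lintegral_enorm_heatDiv_le {τ : ℝ} (hτ : 0 < τ) {G : E2 → E2} (hG : Integrable G) :
    ∫⁻ x, ‖heatDiv τ G x‖ₑ ≤
      ENNReal.ofReal (2 * τ ^ (-(1 / 2) : ℝ)) * ∫⁻ y, ‖G y‖ₑ := by
  calc ∫⁻ x, ‖heatDiv τ G x‖ₑ ≤ ∫⁻ x, ∫⁻ y, ‖gradient (K τ) (x - y)‖ₑ * ‖G y‖ₑ := by
        refine lintegral_mono fun x => (enorm_integral_le_lintegral_enorm _).trans ?_
        exact lintegral_mono fun y => enorm_inner_le _ _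
    _ ≤ _ := by
        rw [lintegral_convolution_le (continuous_gradient_K τ) hG.1]
        exact mul_le_mul' (lintegral_enorm_gradient_K_le hτ) le_rfl

lemma integrable_heatDiv {τ : ℝ} (hτ : 0 < τ) {G : E2 → E2} (hG : Integrable G) :
    Integrable (heatDiv τ G) :=
  ⟨(continuous_heatDiv hτ hG).aestronglyMeasurable,
    (lintegral_enorm_heatDiv_le hτ hG).trans_lt (ENNReal.mul_lt_top ENNReal.ofReal_lt_top hG.2)⟩

/-! ### Measurability of Carathéodory functions -/

lemma aestronglyMeasurable_uncurry_of_continuous {S : Type*} [MeasurableSpace S]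
    {μ : Measure S} [SFinite μ] {E : Type*} [TopologicalSpace E]
    [TopologicalSpace.PseudoMetrizableSpace E] {p : S → E2 → E} (hc : ∀ᵐ s ∂μ, Continuous (p s))
    (hm : ∀ x, AEStronglyMeasurable (fun s => p s x) μ) :
    AEStronglyMeasurable (fun q : S × E2 => p q.1 q.2) (μ.prod volume) := by
  have hid : StronglyMeasurable (id : E2 → E2) := stronglyMeasurable_id
  refine aestronglyMeasurable_of_tendsto_ae atTop
    (f := fun n (q : S × E2) => p q.1 (hid.approx n q.2)) (fun n => ?_) ?_
  · have hU : (⋃ c : (hid.approx n).range,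
        {q : S × E2 | hid.approx n q.2 = c}) = Set.univ := by
      refine Set.eq_univ_of_forall fun q => Set.mem_iUnion.2 ?_
      exact ⟨⟨hid.approx n q.2, SimpleFunc.mem_range_self _ _⟩, rfl⟩
    rw [← Measure.restrict_univ (μ := μ.prod volume), ← hU, aestronglyMeasurable_iUnion_iff]
    intro c
    have hset : MeasurableSet {q : S × E2 | hid.approx n q.2 = c} :=
      ((hid.approx n).measurableSet_fiber c).preimage measurable_snd
    refine ((hm c).comp_fst.restrict).congr ?_
    filter_upwards [ae_restrict_mem hset] with q hq
    rw [show hid.approx n q.2 = c from hq]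
  · filter_upwards [Measure.quasiMeasurePreserving_fst.ae hc] with q hq
    exact (hq.tendsto q.2).comp (hid.tendsto_approx q.2)

/-! ### The Fourier transform of the heat evolution -/

open scoped FourierTransform

lemma fourier_K {τ : ℝ} (hτ : 0 < τ) (ξ : E2) :
    𝓕 (fun x : E2 => (K τ x : ℂ)) ξ = Real.exp (-(4 * π ^ 2 * τ) * ‖ξ‖ ^ 2) := by
  have hb : 0 < ((4 * τ : ℝ) : ℂ)⁻¹.re := by
    rw [← Complex.ofReal_inv, Complex.ofReal_re]
    positivity
  have h := fourier_gaussian_innerProductSpace (V := E2) hb ξ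
  have hτ' : (τ : ℂ) ≠ 0 := by exact_mod_cast hτ.ne'
  have hπ : (π : ℂ) ≠ 0 := by exact_mod_cast Real.pi_ne_zero
  have hK (x : E2) : (K τ x : ℂ) =
      (((4 * π * τ)⁻¹ : ℝ) : ℂ) * Complex.exp (-((4 * τ : ℝ) : ℂ)⁻¹ * ‖x‖ ^ 2) := by
    simp only [K]
    push_cast
    congr 2
    ring
  rw [Real.fourier_eq'] at h ⊢
  simp_rw [hK, smul_eq_mul, mul_left_comm (Complex.exp _) (((4 * π * τ)⁻¹ : ℝ) : ℂ)]
  rw [integral_const_mul]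
  simp_rw [smul_eq_mul] at h
  rw [h]
  simp only [finrank_euclideanSpace, Fintype.card_fin]
  push_cast
  rw [show ((2 : ℂ) / 2) = 1 by norm_num, Complex.cpow_one]
  rw [← mul_assoc, show (4 * (π : ℂ) * τ)⁻¹ * (π / (4 * (τ : ℂ))⁻¹) = 1 by field_simp, one_mul]
  congr 1
  field_simp

lemma differentiable_K (τ : ℝ) : Differentiable ℝ (K τ) := by
  unfold K
  have h : Differentiable ℝ fun x : E2 => ‖x‖ ^ 2 := differentiable_id.norm_sq ℝ
  fun_prop

lemma fderiv_K_apply (τ : ℝ) (x w : E2) :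
    fderiv ℝ (fun x : E2 => (K τ x : ℂ)) x w = (⟪gradient (K τ) x, w⟫ : ℝ) := by
  have h1 : HasFDerivAt (fun x : E2 => (K τ x : ℂ))
      (Complex.ofRealCLM.comp (fderiv ℝ (K τ) x)) x :=
    Complex.ofRealCLM.hasFDerivAt.comp x (differentiable_K τ x).hasFDerivAt
  rw [h1.fderiv, ContinuousLinearMap.comp_apply, Complex.ofRealCLM_apply, gradient,
    InnerProductSpace.toDual_symm_apply]

lemma integrable_K {τ : ℝ} (hτ : 0 < τ) : Integrable (K τ) :=
  ⟨(continuous_K τ).aestronglyMeasurable, by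
    rw [hasFiniteIntegral_iff_enorm, lintegral_enorm_K hτ]; exact ENNReal.one_lt_top⟩

lemma fourier_inner_gradient_K {τ : ℝ} (hτ : 0 < τ) (w ξ : E2) :
    ∫ x, 𝐞 (-⟪x, ξ⟫) • ((⟪gradient (K τ) x, w⟫ : ℝ) : ℂ) =
      2 * π * Complex.I * ⟪w, ξ⟫ * Real.exp (-(4 * π ^ 2 * τ) * ‖ξ‖ ^ 2) := by
  have hd : Differentiable ℝ (fun x : E2 => (K τ x : ℂ)) := fun x =>
    (Complex.ofRealCLM.hasFDerivAt.comp x (differentiable_K τ x).hasFDerivAt).differentiableAt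
  have he (x : E2) : ‖fderiv ℝ (fun x : E2 => (K τ x : ℂ)) x‖ ≤ ‖gradient (K τ) x‖ := by
    refine ContinuousLinearMap.opNorm_le_bound _ (norm_nonneg _) fun v => ?_
    rw [fderiv_K_apply, Complex.norm_real]
    exact norm_inner_le_norm _ _
  have hi : Integrable (fderiv ℝ (fun x : E2 => (K τ x : ℂ))) :=
    (integrable_gradient_K hτ).mono (measurable_fderiv ℝ _).aestronglyMeasurable (ae_of_all _ he)
  have h := Real.fourier_fderiv (integrable_K hτ).ofReal hd hi
  have h2 := congrArg (fun L => L w) (congrFun h ξ)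
  beta_reduce at h2
  rw [Real.fourier_continuousLinearMap_apply hi, Real.fourier_eq] at h2
  simp_rw [fderiv_K_apply] at h2
  rw [h2, VectorFourier.fourierSMulRight_apply, fourier_K hτ]
  have hL : ((-innerSL ℝ : E2 →L[ℝ] E2 →L[ℝ] ℝ) ξ) w = -⟪w, ξ⟫ := by
    rw [real_inner_comm ξ w]
    rfl
  rw [hL, smul_eq_mul, Complex.real_smul]
  push_cast
  ring

lemma integrable_prod_heatDiv_integrand {τ : ℝ} (hτ : 0 < τ) {G : E2 → E2} (hG : Integrable G) :
    Integrable (fun p : E2 × E2 => ⟪gradient (K τ) (p.1 - p.2), G p.2⟫)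
      (volume.prod volume) := by
  have hk : AEStronglyMeasurable (fun p : E2 × E2 => gradient (K τ) (p.1 - p.2))
      (volume.prod volume) :=
    ((continuous_gradient_K τ).comp (continuous_fst.sub continuous_snd)).aestronglyMeasurable
  have hm := hk.inner (𝕜 := ℝ) hG.1.comp_snd
  refine ⟨hm, ?_⟩
  rw [hasFiniteIntegral_iff_enorm, lintegral_prod _ hm.enorm]
  calc _ ≤ ∫⁻ x, ∫⁻ y, ‖gradient (K τ) (x - y)‖ₑ * ‖G y‖ₑ :=
        lintegral_mono fun x => lintegral_mono fun y => enorm_inner_le _ _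
    _ = _ := lintegral_convolution_le (continuous_gradient_K τ) hG.1
    _ < ∞ := ENNReal.mul_lt_top (integrable_gradient_K hτ).2 hG.2

lemma fourier_heatDiv {τ : ℝ} (hτ : 0 < τ) {G : E2 → E2} (hG : Integrable G) (ξ : E2) :
    𝓕 (fun x => (heatDiv τ G x : ℂ)) ξ = Real.exp (-(4 * π ^ 2 * τ) * ‖ξ‖ ^ 2) *
      ∫ y, 𝐞 (-⟪y, ξ⟫) • (2 * π * Complex.I * (⟪G y, ξ⟫ : ℝ)) := by
  have hi : Integrable (fun p : E2 × E2 =>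
      𝐞 (-⟪p.1, ξ⟫) • ((⟪gradient (K τ) (p.1 - p.2), G p.2⟫ : ℝ) : ℂ))
      (volume.prod volume) := by
    refine (integrable_prod_heatDiv_integrand hτ hG).ofReal (𝕜 := ℂ) |>.mono ?_
      (ae_of_all _ fun p => ?_)
    · refine AEStronglyMeasurable.smul (Continuous.aestronglyMeasurable ?_)
        (integrable_prod_heatDiv_integrand hτ hG).ofReal.1
      fun_prop
    · rw [Circle.norm_smul]
      exact le_rfl
  rw [Real.fourier_eq]
  calc _ = ∫ x, ∫ y, 𝐞 (-⟪x, ξ⟫) • ((⟪gradient (K τ) (x - y), G y⟫ : ℝ) : ℂ) := by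
        refine integral_congr_ae (ae_of_all _ fun x => ?_)
        beta_reduce
        rw [heatDiv, ← integral_complex_ofReal]
        simp only [Circle.smul_def]
        rw [integral_smul]
    _ = ∫ y, ∫ x, 𝐞 (-⟪x, ξ⟫) • ((⟪gradient (K τ) (x - y), G y⟫ : ℝ) : ℂ) :=
        integral_integral_swap hi
    _ = ∫ y, Real.exp (-(4 * π ^ 2 * τ) * ‖ξ‖ ^ 2) *
          (𝐞 (-⟪y, ξ⟫) • (2 * π * Complex.I * (⟪G y, ξ⟫ : ℝ))) := by
        refine integral_congr_ae (ae_of_all _ fun y => ?_)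
        beta_reduce
        rw [← integral_add_right_eq_self _ y]
        simp only [add_sub_cancel_right, inner_add_left, neg_add, AddChar.map_add_eq_mul,
          mul_comm _ (𝐞 (-⟪y, ξ⟫)), mul_smul]
        simp only [Circle.smul_def (𝐞 (-⟪y, ξ⟫))]
        rw [integral_smul, fourier_inner_gradient_K hτ]
        simp only [smul_eq_mul]
        ring
    _ = _ := integral_const_mul _ _


lemma fourier_heatDiv_eq_exp_mul {τ σ : ℝ} (hτ : 0 < τ) (hσ : 0 < σ) {G : E2 → E2}
    (hG : Integrable G) (ξ : E2) :
    𝓕 (fun x => (heatDiv τ G x : ℂ)) ξ = Real.exp (-(4 * π ^ 2 * (τ - σ)) * ‖ξ‖ ^ 2) *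
      𝓕 (fun x => (heatDiv σ G x : ℂ)) ξ := by
  rw [fourier_heatDiv hτ hG, fourier_heatDiv hσ hG, ← mul_assoc, ← Complex.ofReal_mul,
    ← Real.exp_add]
  congr 4
  ring

lemma continuous_fourier {f : E2 → ℂ} (hf : Integrable f) : Continuous (𝓕 f) :=
  VectorFourier.fourierIntegral_continuous Real.continuous_fourierChar
    (L := innerₗ E2) (by simpa using continuous_inner) hf

lemma integrable_fourier_heatDiv {τ : ℝ} (hτ : 0 < τ) {G : E2 → E2} (hG : Integrable G) :
    Integrable (𝓕 (fun x => (heatDiv τ G x : ℂ))) := by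
  have hτ2 : 0 < τ / 2 := half_pos hτ
  have hi : Integrable (fun x => (heatDiv τ G x : ℂ)) := (integrable_heatDiv hτ hG).ofReal
  have hb : 0 < ((2 * π ^ 2 * τ : ℝ) : ℂ).re := by
    rw [Complex.ofReal_re]
    positivity
  have hg := (GaussianFourier.integrable_cexp_neg_mul_sq_norm_add (V := E2) hb 0 0).norm.mul_const
    (∫ x, ‖(heatDiv (τ / 2) G x : ℂ)‖)
  refine hg.mono (continuous_fourier hi).aestronglyMeasurable (ae_of_all _ fun ξ => ?_)
  rw [fourier_heatDiv_eq_exp_mul hτ hτ2 hG, norm_mul, norm_mul, norm_norm]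
  gcongr
  · rw [Complex.norm_exp, Complex.norm_real, Real.norm_of_nonneg (Real.exp_pos _).le, zero_mul,
      add_zero, ← Complex.ofReal_pow, ← Complex.ofReal_neg, ← Complex.ofReal_mul,
      Complex.ofReal_re]
    apply le_of_eq
    congr 1
    ring
  · refine (VectorFourier.norm_fourierIntegral_le_integral_norm _ _ _ _ _).trans (le_abs_self _)

lemma heatDiv_eq_integral_fourier {τ : ℝ} (hτ : 0 < τ) {G : E2 → E2} (hG : Integrable G) (x : E2) :
    (heatDiv τ G x : ℂ) = ∫ ξ, 𝐞 ⟪ξ, x⟫ • 𝓕 (fun x => (heatDiv τ G x : ℂ)) ξ := by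
  have h := Continuous.fourierInv_fourier_eq
    (Complex.continuous_ofReal.comp (continuous_heatDiv hτ hG))
    (integrable_heatDiv hτ hG).ofReal (integrable_fourier_heatDiv hτ hG)
  rw [← Real.fourierInv_eq]
  exact (congrFun h x).symm

/-- Measurability in time of `s ↦ heatDiv (t - s) (G s) x` does not depend on `t`. -/
lemma aestronglyMeasurable_heatDiv_of_time {μ : Measure ℝ} [SFinite μ] {G : ℝ → E2 → E2}
    {t t' : ℝ} (hμ : ∀ᵐ s ∂μ, s < t ∧ s < t' ∧ Integrable (G s))
    (hm : ∀ x, AEStronglyMeasurable (fun s => heatDiv (t - s) (G s) x) μ) (x : E2) :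
    AEStronglyMeasurable (fun s => heatDiv (t' - s) (G s) x) μ := by
  have h1 : AEStronglyMeasurable (fun q : ℝ × E2 => heatDiv (t - q.1) (G q.1) q.2)
      (μ.prod volume) :=
    aestronglyMeasurable_uncurry_of_continuous (p := fun s => heatDiv (t - s) (G s))
      (hμ.mono fun s hs => continuous_heatDiv (sub_pos.2 hs.1) hs.2.2) hm
  have h2 (ξ : E2) : AEStronglyMeasurable
      (fun s => 𝓕 (fun x => (heatDiv (t - s) (G s) x : ℂ)) ξ) μ := by
    simp_rw [Real.fourier_eq]
    refine AEStronglyMeasurable.integral_prod_right'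
      (f := fun q : ℝ × E2 => 𝐞 (-⟪q.2, ξ⟫) • (heatDiv (t - q.1) (G q.1) q.2 : ℂ)) ?_
    refine AEStronglyMeasurable.smul (Continuous.aestronglyMeasurable (by fun_prop)) ?_
    exact Complex.continuous_ofReal.comp_aestronglyMeasurable h1
  have h3 (ξ : E2) : AEStronglyMeasurable
      (fun s => 𝓕 (fun x => (heatDiv (t' - s) (G s) x : ℂ)) ξ) μ := by
    refine ((h2 ξ).const_mul (Real.exp (-(4 * π ^ 2 * (t' - t)) * ‖ξ‖ ^ 2) : ℂ)).congr ?_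
    filter_upwards [hμ] with s hs
    rw [fourier_heatDiv_eq_exp_mul (sub_pos.2 hs.2.1) (sub_pos.2 hs.1) hs.2.2]
    congr 5
    ring
  have h4 : AEStronglyMeasurable
      (fun q : ℝ × E2 => 𝓕 (fun x => (heatDiv (t' - q.1) (G q.1) x : ℂ)) q.2) (μ.prod volume) :=
    aestronglyMeasurable_uncurry_of_continuous
      (p := fun s => 𝓕 (fun x => (heatDiv (t' - s) (G s) x : ℂ)))
      (hμ.mono fun s hs => continuous_fourier
        (integrable_heatDiv (sub_pos.2 hs.2.1) hs.2.2).ofReal) h3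
  have h5 : AEStronglyMeasurable (fun s => ∫ ξ, 𝐞 ⟪ξ, x⟫ •
      𝓕 (fun x => (heatDiv (t' - s) (G s) x : ℂ)) ξ) μ := by
    refine AEStronglyMeasurable.integral_prod_right' (f := fun q : ℝ × E2 => 𝐞 ⟪q.2, x⟫ •
      𝓕 (fun x => (heatDiv (t' - q.1) (G q.1) x : ℂ)) q.2) ?_
    exact AEStronglyMeasurable.smul (Continuous.aestronglyMeasurable (by fun_prop)) h4
  refine (Complex.continuous_re.comp_aestronglyMeasurable h5).congr ?_
  filter_upwards [hμ] with s hs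
  rw [← heatDiv_eq_integral_fourier (sub_pos.2 hs.2.1) hs.2.2, Complex.ofReal_re]

/-! ### Analyticity in space -/

lemma aestronglyMeasurable_of_entire {S : Type*} [MeasurableSpace S] {μ : Measure S}
    {F : S → ℂ → ℂ} (hF : ∀ᵐ s ∂μ, Differentiable ℂ (F s)) {ε : ℝ} (hε : 0 < ε)
    (hm : ∀ r : ℝ, 0 < r → r < ε → AEStronglyMeasurable (fun s => F s r) μ) (z : ℂ) :
    AEStronglyMeasurable (fun s => F s z) μ := by
  have hd (n : ℕ) : ∀ r : ℝ, 0 < r → r < ε →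
      AEStronglyMeasurable (fun s => iteratedDeriv n (F s) r) μ := by
    induction n with
    | zero => simpa only [iteratedDeriv_zero] using hm
    | succ n ih =>
      intro r hr hrε
      have hδ : 0 < ε - r := sub_pos.2 hrε
      let δ (j : ℕ) : ℝ := (ε - r) / (j + 2)
      have hδ_pos (j : ℕ) : 0 < δ j := by positivity
      have hδ_lt (j : ℕ) : r + δ j < ε := by
        have : δ j < ε - r := div_lt_self hδ (by linarith [j.cast_nonneg (α := ℝ)])
        linarith
      have hδ_lim : Tendsto δ atTop (𝓝 0) := tendsto_const_nhds.div_atTop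
        (tendsto_atTop_add_const_right _ _ tendsto_natCast_atTop_atTop)
      refine aestronglyMeasurable_of_tendsto_ae atTop
        (f := fun (j : ℕ) s => (δ j : ℂ)⁻¹ *
          (iteratedDeriv n (F s) (r + δ j) - iteratedDeriv n (F s) r))
        (fun j => ?_) ?_
      · have h1 := ih (r + δ j) (by linarith [hδ_pos j]) (hδ_lt j)
        rw [Complex.ofReal_add] at h1
        exact (h1.sub (ih r hr hrε)).const_mul _
      · filter_upwards [hF] with s hs
        have h2 : HasDerivAt (iteratedDeriv n (F s)) (iteratedDeriv (n + 1) (F s) r) r := by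
          rw [iteratedDeriv_succ]
          exact ((hs.contDiff (n := (n + 1 : ℕ))).differentiable_iteratedDeriv n
            (mod_cast n.lt_succ_self) r).hasDerivAt
        have h3 : Tendsto (fun j => (δ j : ℂ)) atTop (𝓝[≠] 0) := by
          refine tendsto_nhdsWithin_iff.2 ⟨?_, Eventually.of_forall fun j => ?_⟩
          · exact (Complex.continuous_ofReal.tendsto' 0 0 Complex.ofReal_zero).comp hδ_lim
          · exact Complex.ofReal_ne_zero.2 (hδ_pos j).ne'
        exact h2.tendsto_slope_zero.comp h3
  refine aestronglyMeasurable_of_tendsto_ae atTop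
    (f := fun (N : ℕ) s => ∑ n ∈ Finset.range N, ((n.factorial : ℂ)⁻¹ *
      ((z - ((ε / 2 : ℝ) : ℂ)) ^ n * iteratedDeriv n (F s) ((ε / 2 : ℝ) : ℂ))))
    (fun N => ?_) ?_
  · exact Finset.aestronglyMeasurable_fun_sum _ fun n _ =>
      ((hd n (ε / 2) (by positivity) (by linarith)).const_mul _).const_mul _
  · filter_upwards [hF] with s hs
    exact (Complex.hasSum_taylorSeries_of_entire hs ((ε / 2 : ℝ) : ℂ) z).tendsto_sum_nat

lemma integrable_exp_mul_norm_mul_exp {c : ℝ} (hc : 0 < c) (b : ℝ) :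
    Integrable (fun ξ : E2 => Real.exp (b * ‖ξ‖) * Real.exp (-c * ‖ξ‖ ^ 2)) := by
  have hc' : 0 < ((c / 2 : ℝ) : ℂ).re := by
    rw [Complex.ofReal_re]
    positivity
  have hg := (GaussianFourier.integrable_cexp_neg_mul_sq_norm_add (V := E2) hc' 0 0).norm.const_mul
    (Real.exp (b ^ 2 / (2 * c)))
  refine hg.mono (Continuous.aestronglyMeasurable (by fun_prop)) (ae_of_all _ fun ξ => ?_)
  rw [Complex.norm_exp, zero_mul, add_zero, ← Complex.ofReal_pow, ← Complex.ofReal_neg,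
    ← Complex.ofReal_mul, Complex.ofReal_re, ← Real.exp_add, ← Real.exp_add, Real.norm_eq_abs,
    Real.norm_eq_abs, Real.abs_exp, Real.abs_exp, Real.exp_le_exp]
  have : b ^ 2 / (2 * c) + -(c / 2) * ‖ξ‖ ^ 2 - (b * ‖ξ‖ + -c * ‖ξ‖ ^ 2) =
      (b - c * ‖ξ‖) ^ 2 / (2 * c) := by
    field_simp
    ring
  have h2 : 0 ≤ (b - c * ‖ξ‖) ^ 2 / (2 * c) := by positivity
  linarith

lemma exists_norm_fourier_heatDiv_le {τ : ℝ} (hτ : 0 < τ) {G : E2 → E2} (hG : Integrable G) :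
    ∃ A : ℝ, ∀ ξ, ‖𝓕 (fun x => (heatDiv τ G x : ℂ)) ξ‖ ≤
      A * Real.exp (-(2 * π ^ 2 * τ) * ‖ξ‖ ^ 2) := by
  refine ⟨∫ x, ‖(heatDiv (τ / 2) G x : ℂ)‖, fun ξ => ?_⟩
  rw [fourier_heatDiv_eq_exp_mul hτ (half_pos hτ) hG, norm_mul, mul_comm, Complex.norm_real,
    Real.norm_of_nonneg (Real.exp_pos _).le]
  refine mul_le_mul (VectorFourier.norm_fourierIntegral_le_integral_norm _ _ _ _ _)
    (le_of_eq ?_) (Real.exp_pos _).le (integral_nonneg fun _ => norm_nonneg _)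
  congr 1
  ring

lemma exists_entire_heatDiv {τ : ℝ} (hτ : 0 < τ) {G : E2 → E2} (hG : Integrable G) (x e : E2) :
    ∃ F : ℂ → ℂ, Differentiable ℂ F ∧ ∀ r : ℝ, F r = heatDiv τ G (x + r • e) := by
  set H := 𝓕 (fun x => (heatDiv τ G x : ℂ)) with hH
  obtain ⟨A, hA⟩ := exists_norm_fourier_heatDiv_le hτ hG
  have hHc : Continuous H := continuous_fourier (integrable_heatDiv hτ hG).ofReal
  have hHi : Integrable H := integrable_fourier_heatDiv hτ hG
  let w (ξ : E2) : ℂ := 2 * π * Complex.I * (⟪ξ, e⟫ : ℝ)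
  have hw (ξ : E2) : ‖w ξ‖ ≤ 2 * π * ‖e‖ * ‖ξ‖ := by
    simp only [w, norm_mul, Complex.norm_I, Complex.norm_real, Complex.norm_ofNat, mul_one]
    rw [Real.norm_of_nonneg pi_pos.le, mul_assoc (2 * π), mul_comm ‖e‖]
    gcongr
    exact norm_inner_le_norm _ _
  have hwc : Continuous w := by fun_prop
  let f (z : ℂ) (ξ : E2) : ℂ := Complex.exp (z * w ξ) * (𝐞 ⟪ξ, x⟫ • H ξ)
  have hfc (z : ℂ) : Continuous (f z) := by fun_prop
  refine ⟨fun z => ∫ ξ : E2, f z ξ, fun z => ?_, fun r => ?_⟩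
  · have hb : Integrable (fun ξ : E2 => Real.exp ((2 * π * ‖e‖ * (‖z‖ + 2)) * ‖ξ‖) *
        Real.exp (-(2 * π ^ 2 * τ) * ‖ξ‖ ^ 2) * A) volume :=
      (integrable_exp_mul_norm_mul_exp (by positivity) _).mul_const A
    have hf (z' : ℂ) (ξ : E2) (hz : z' ∈ Metric.ball z 1) : ‖f z' ξ‖ ≤
        Real.exp ((2 * π * ‖e‖ * (‖z‖ + 1)) * ‖ξ‖) *
        Real.exp (-(2 * π ^ 2 * τ) * ‖ξ‖ ^ 2) * A := by
      have hz' : ‖z'‖ ≤ ‖z‖ + 1 := by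
        have := norm_sub_norm_le z' z
        rw [Metric.mem_ball, dist_eq_norm] at hz
        linarith
      have h2 : ‖Complex.exp (z' * w ξ)‖ ≤ Real.exp ((2 * π * ‖e‖ * (‖z‖ + 1)) * ‖ξ‖) := by
        refine (Complex.norm_exp_le_exp_norm _).trans (Real.exp_le_exp.2 ?_)
        rw [norm_mul]
        refine (mul_le_mul hz' (hw ξ) (norm_nonneg _) (by positivity)).trans_eq ?_
        ring
      have h3 : ‖𝐞 ⟪ξ, x⟫ • H ξ‖ ≤ Real.exp (-(2 * π ^ 2 * τ) * ‖ξ‖ ^ 2) * A := by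
        rw [Circle.norm_smul, mul_comm]
        exact hA ξ
      rw [mul_assoc]
      simp only [f, norm_mul]
      gcongr
    have hf' (z' : ℂ) (ξ : E2) (hz : z' ∈ Metric.ball z 1) : ‖w ξ * f z' ξ‖ ≤
        Real.exp ((2 * π * ‖e‖ * (‖z‖ + 2)) * ‖ξ‖) *
        Real.exp (-(2 * π ^ 2 * τ) * ‖ξ‖ ^ 2) * A := by
      have h1 : ‖w ξ‖ ≤ Real.exp (2 * π * ‖e‖ * ‖ξ‖) :=
        (hw ξ).trans (by linarith [Real.add_one_le_exp (2 * π * ‖e‖ * ‖ξ‖)])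
      rw [norm_mul]
      refine (mul_le_mul h1 (hf z' ξ hz) (norm_nonneg _) (Real.exp_pos _).le).trans_eq ?_
      rw [← mul_assoc, ← mul_assoc, ← Real.exp_add]
      congr 3
      ring
    have hfi : Integrable (f z) :=
      ((integrable_exp_mul_norm_mul_exp (by positivity) _).mul_const A).mono'
        (hfc z).aestronglyMeasurable
        (ae_of_all _ fun ξ => hf z ξ (Metric.mem_ball_self one_pos))
    exact (hasDerivAt_integral_of_dominated_loc_of_deriv_le (μ := volume)
      (F := f) (F' := fun z ξ => w ξ * f z ξ)
      (Metric.ball_mem_nhds z one_pos)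
      (Eventually.of_forall fun z => (hfc z).aestronglyMeasurable) hfi
      (hwc.mul (hfc z)).aestronglyMeasurable
      (ae_of_all _ fun ξ z' hz => hf' z' ξ hz) hb
      (ae_of_all _ fun ξ z' _ => by
        have h := (((hasDerivAt_id z').mul_const (w ξ)).cexp).mul_const (𝐞 ⟪ξ, x⟫ • H ξ)
        refine h.congr_deriv ?_
        simp only [f, id]
        ring)).2.differentiableAt
  · rw [heatDiv_eq_integral_fourier hτ hG]
    refine integral_congr_ae (ae_of_all _ fun ξ => ?_)
    simp only [f, w]
    rw [inner_add_right, AddChar.map_add_eq_mul, mul_comm (𝐞 _), mul_smul,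
      Circle.smul_def (𝐞 ⟪ξ, r • e⟫), Real.fourierChar_apply, inner_smul_right, smul_eq_mul]
    congr 2
    push_cast
    ring

/-- Measurability in time of `s ↦ heatDiv (τ s) (G s) x` propagates in `x`. -/
lemma aestronglyMeasurable_heatDiv_of_ball {μ : Measure ℝ} {G : ℝ → E2 → E2} {τ : ℝ → ℝ}
    (hμ : ∀ᵐ s ∂μ, 0 < τ s ∧ Integrable (G s)) {x₀ : E2} {ε : ℝ} (hε : 0 < ε)
    (hm : ∀ x ∈ Metric.ball x₀ ε, AEStronglyMeasurable (fun s => heatDiv (τ s) (G s) x) μ)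
    (x : E2) : AEStronglyMeasurable (fun s => heatDiv (τ s) (G s) x) μ := by
  have hF (s : ℝ) : ∃ F : ℂ → ℂ, (0 < τ s ∧ Integrable (G s)) → Differentiable ℂ F ∧
      ∀ r : ℝ, F r = heatDiv (τ s) (G s) (x₀ + r • (x - x₀)) := by
    by_cases h : 0 < τ s ∧ Integrable (G s)
    · obtain ⟨F, hF⟩ := exists_entire_heatDiv h.1 h.2 x₀ (x - x₀)
      exact ⟨F, fun _ => hF⟩
    · exact ⟨0, fun h' => absurd h' h⟩
  choose F hF using hF
  have h1 := aestronglyMeasurable_of_entire (F := F) (hμ.mono fun s hs => (hF s hs).1)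
    (ε := ε / (‖x - x₀‖ + 1)) (by positivity) (fun r hr hrε => by
      refine (Complex.continuous_ofReal.comp_aestronglyMeasurable
        (hm (x₀ + r • (x - x₀)) ?_)).congr (hμ.mono fun s hs => ((hF s hs).2 r).symm)
      rw [Metric.mem_ball, dist_eq_norm, add_sub_cancel_left, norm_smul, Real.norm_of_nonneg hr.le]
      rw [lt_div_iff₀ (by positivity)] at hrε
      linarith) ((1 : ℝ) : ℂ)
  refine (Complex.continuous_re.comp_aestronglyMeasurable h1).congr (hμ.mono fun s hs => ?_)
  beta_reduce
  rw [(hF s hs).2 1, one_smul, add_sub_cancel, Complex.ofReal_re]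

/-! ### Measurability in time of the Duhamel integrand -/

/-- The vorticity flux `ω v` at time `s`. -/
def flux (ω : ℝ → E2 → ℝ) (s : ℝ) : E2 → E2 := vortFlux (ω s) (ω s)

/-- The Duhamel integrand at time `t` is measurable in the time variable. -/
def DuhamelMeasurable (ω : ℝ → E2 → ℝ) (t : ℝ) : Prop :=
  ∀ x, AEStronglyMeasurable (fun s => heatDiv (t - s) (flux ω s) x)
    (volume.restrict (Set.Ioc 0 t))

lemma IsMildSolution.eq_heat_add {ω₀ : E2 → ℝ} {T : ℝ} {ω : ℝ → E2 → ℝ}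
    (h : IsMildSolution ω₀ T ω) {t : ℝ} (ht : t ∈ Set.Ioc 0 T) (x : E2) :
    ω t x = heat t ω₀ x + ∫ s in Set.Ioc 0 t, heatDiv (t - s) (flux ω s) x :=
  h t ht x

lemma ae_restrict_Ioc_lt (t : ℝ) : ∀ᵐ s ∂volume.restrict (Set.Ioc 0 t), 0 < s ∧ s < t := by
  rw [← restrict_Ioo_eq_restrict_Ioc]
  exact ae_restrict_mem measurableSet_Ioo

lemma measurable_heat_uncurry {f : E2 → ℝ} (hf : Measurable f) :
    Measurable (fun p : ℝ × E2 => heat p.1 f p.2) := by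
  refine (StronglyMeasurable.integral_prod_right' (ν := volume)
    (f := fun q : (ℝ × E2) × E2 => K q.1.1 (q.1.2 - q.2) * f q.2) ?_).measurable
  refine Measurable.stronglyMeasurable (Measurable.mul ?_ (hf.comp measurable_snd))
  exact measurable_K_uncurry.comp (by fun_prop : Measurable fun q : (ℝ × E2) × E2 =>
    (q.1.1, q.1.2 - q.2))

lemma stronglyMeasurable_heatDiv_flux_heat {f : E2 → ℝ} (hf : Measurable f) (t : ℝ) (x : E2) :
    StronglyMeasurable (fun s => heatDiv (t - s) (flux (fun s => heat s f) s) x) := by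
  refine StronglyMeasurable.integral_prod_right' (ν := volume)
    (f := fun q : ℝ × E2 => ⟪gradient (K (t - q.1)) (x - q.2),
      flux (fun s => heat s f) q.1 q.2⟫) ?_
  have h := measurable_heat_uncurry hf
  refine Measurable.stronglyMeasurable (Measurable.inner ?_ ?_)
  · exact measurable_gradient_K_uncurry.comp (by fun_prop : Measurable fun q : ℝ × E2 =>
      (t - q.1, x - q.2))
  · exact h.smul (measurable_biotSavart_uncurry (g := fun s => heat s f) h)

section

variable {ω₀ : E2 → ℝ} {T : ℝ} {ω : ℝ → E2 → ℝ}

lemma integrable_flux (hω : ∀ t ∈ Set.Ioc 0 T, MemW11 (ω t)) {s : ℝ} (hs : s ∈ Set.Ioc 0 T) :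
    Integrable (flux ω s) :=
  integrable_vortFlux (hω s hs) (hω s hs)

lemma duhamelMeasurable_or_eq_heat (h₀ : Integrable ω₀) (hω : ∀ t ∈ Set.Ioc 0 T, MemW11 (ω t))
    (hmild : IsMildSolution ω₀ T ω) {t : ℝ} (ht : t ∈ Set.Ioc 0 T) :
    DuhamelMeasurable ω t ∨ ω t = heat t ω₀ := by
  have hμ : ∀ᵐ s ∂volume.restrict (Set.Ioc 0 t), 0 < t - s ∧ Integrable (flux ω s) :=
    (ae_restrict_Ioc_lt t).mono fun s hs =>
      ⟨sub_pos.2 hs.2, integrable_flux hω ⟨hs.1, hs.2.le.trans ht.2⟩⟩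
  by_cases hd : Dense {x | ¬ AEStronglyMeasurable (fun s => heatDiv (t - s) (flux ω s) x)
    (volume.restrict (Set.Ioc 0 t))}
  · refine Or.inr (Continuous.ext_on hd (hω t ht).2.1.continuous (continuous_heat ht.1 h₀)
      fun x hx => ?_)
    rw [hmild.eq_heat_add ht, integral_non_aestronglyMeasurable hx, add_zero]
  · rw [Metric.dense_iff] at hd
    push Not at hd
    obtain ⟨x₀, ε, hε, hball⟩ := hd
    refine Or.inl (aestronglyMeasurable_heatDiv_of_ball (x₀ := x₀) hμ hε fun x hx => ?_)
    by_contra hcon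
    exact Set.eq_empty_iff_forall_notMem.1 hball x ⟨hx, hcon⟩

lemma duhamelMeasurable (h₀ : MemW11 ω₀) (hω : ∀ t ∈ Set.Ioc 0 T, MemW11 (ω t))
    (hmild : IsMildSolution ω₀ T ω) {t : ℝ} (ht : t ∈ Set.Ioc 0 T) : DuhamelMeasurable ω t := by
  intro x
  let A : Set ℝ := {a | a ∈ Set.Ioc 0 T ∧ DuhamelMeasurable ω a}
  let Q : Set ℚ := {q | ∃ a ∈ A, (q : ℝ) < a}
  let B : Set ℝ := ⋃ q : Q, Set.Iic (q : ℝ)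
  have hB : MeasurableSet B := MeasurableSet.iUnion fun q => measurableSet_Iic
  have hlt (s : ℝ) (hs : s ∈ A) (s' : ℝ) (hs' : s' ∈ A) (h : s < s') : s ∈ B := by
    obtain ⟨q, hq, hq'⟩ := exists_rat_btwn h
    exact Set.mem_iUnion.2 ⟨⟨q, s', hs', hq'⟩, hq.le⟩
  have hsub : (A \ B).Subsingleton := fun s hs s' hs' => by
    rcases lt_trichotomy s s' with h | h | h
    · exact absurd (hlt s hs.1 s' hs'.1 h) hs.2
    · exact h
    · exact absurd (hlt s' hs'.1 s hs.1 h) hs'.2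
  rw [← Set.inter_union_sdiff (Set.Ioc 0 t) B, aestronglyMeasurable_union_iff]
  constructor
  · rw [Set.inter_iUnion, aestronglyMeasurable_iUnion_iff]
    rintro ⟨q, a, ha, hqa⟩
    refine aestronglyMeasurable_heatDiv_of_time (t := a) ?_ (fun x => ?_) x
    · filter_upwards [ae_mono (Measure.restrict_mono_set volume Set.inter_subset_left)
        (ae_restrict_Ioc_lt t), ae_restrict_mem (measurableSet_Ioc.inter measurableSet_Iic)]
        with s hs hs'
      exact ⟨lt_of_le_of_lt hs'.2 hqa, hs.2, integrable_flux hω ⟨hs.1, hs.2.le.trans ht.2⟩⟩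
    · have hqt : Set.Ioc 0 t ∩ Set.Iic (q : ℝ) ⊆ Set.Ioc 0 a :=
        fun s hs => ⟨hs.1.1, (lt_of_le_of_lt hs.2 hqa).le⟩
      exact (ha.2 x).mono_set hqt
  · refine (stronglyMeasurable_heatDiv_flux_heat h₀.measurable t x).aestronglyMeasurable.congr ?_
    filter_upwards [ae_restrict_mem (measurableSet_Ioc.diff hB),
      ae_restrict_of_ae (measure_eq_zero_iff_ae_notMem.1 (hsub.measure_zero volume))] with s hs hs'
    have hsT : s ∈ Set.Ioc 0 T := ⟨hs.1.1, hs.1.2.trans ht.2⟩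
    rcases duhamelMeasurable_or_eq_heat h₀.1 hω hmild hsT with h | h
    · exact absurd ⟨⟨hsT, h⟩, hs.2⟩ hs'
    · rw [flux, flux, h]

end

/-! ### Estimates for the Duhamel term -/

lemma lintegral_Ioc_rpow {t : ℝ} (ht : 0 < t) :
    ∫⁻ s in Set.Ioc 0 t, ENNReal.ofReal (2 * (t - s) ^ (-(1 / 2) : ℝ)) =
      ENNReal.ofReal (4 * √t) := by
  have hi : IntervalIntegrable (fun s : ℝ => 2 * (t - s) ^ (-(1 / 2) : ℝ)) volume 0 t := by
    have h := (intervalIntegral.intervalIntegrable_rpow' (a := 0) (b := t)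
      (by norm_num : (-1 : ℝ) < -(1 / 2))).comp_sub_left t
    rw [sub_zero, sub_self] at h
    exact h.symm.const_mul 2
  rw [← ofReal_integral_eq_lintegral_ofReal
    ((intervalIntegrable_iff_integrableOn_Ioc_of_le ht.le).1 hi), ← intervalIntegral.integral_of_le
    ht.le]
  · congr 1
    rw [intervalIntegral.integral_const_mul,
      intervalIntegral.integral_comp_sub_left (fun s : ℝ => s ^ (-(1 / 2) : ℝ)) t, sub_self,
      sub_zero, integral_rpow (Or.inl (by norm_num))]
    norm_num [Real.sqrt_eq_rpow]
    ring
  · filter_upwards [ae_restrict_Ioc_lt t] with s hs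
    have : 0 < t - s := sub_pos.2 hs.2
    positivity

section

variable {t : ℝ} {G : ℝ → E2 → E2} {N : ℝ≥0∞}

lemma lintegral_lintegral_enorm_heatDiv_le (ht : 0 < t) (hG : ∀ s ∈ Set.Ioo 0 t, Integrable (G s))
    (hm : ∀ x, AEStronglyMeasurable (fun s => heatDiv (t - s) (G s) x)
      (volume.restrict (Set.Ioc 0 t)))
    (hN : ∀ s ∈ Set.Ioo 0 t, ∫⁻ y, ‖G s y‖ₑ ≤ N) :
    AEMeasurable (fun q : ℝ × E2 => ‖heatDiv (t - q.1) (G q.1) q.2‖ₑ)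
      ((volume.restrict (Set.Ioc 0 t)).prod volume) ∧
    ∫⁻ x, ∫⁻ s in Set.Ioc 0 t, ‖heatDiv (t - s) (G s) x‖ₑ ≤ ENNReal.ofReal (4 * √t) * N := by
  have hmeas : AEMeasurable (fun q : ℝ × E2 => ‖heatDiv (t - q.1) (G q.1) q.2‖ₑ)
      ((volume.restrict (Set.Ioc 0 t)).prod volume) := by
    refine (aestronglyMeasurable_uncurry_of_continuous (p := fun s => heatDiv (t - s) (G s))
      ?_ hm).enorm
    filter_upwards [ae_restrict_Ioc_lt t] with s hs
    exact continuous_heatDiv (sub_pos.2 hs.2) (hG s hs)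
  refine ⟨hmeas, ?_⟩
  rw [← lintegral_lintegral_swap hmeas, ← lintegral_Ioc_rpow ht, ← lintegral_mul_const'']
  · refine lintegral_mono_ae ?_
    filter_upwards [ae_restrict_Ioc_lt t] with s hs
    refine (lintegral_enorm_heatDiv_le (sub_pos.2 hs.2) (hG s hs)).trans ?_
    gcongr
    exact hN s hs
  · exact Measurable.aemeasurable (by fun_prop)

lemma lintegral_enorm_integral_heatDiv_le (ht : 0 < t) (hG : ∀ s ∈ Set.Ioo 0 t, Integrable (G s))
    (hm : ∀ x, AEStronglyMeasurable (fun s => heatDiv (t - s) (G s) x)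
      (volume.restrict (Set.Ioc 0 t)))
    (hN : ∀ s ∈ Set.Ioo 0 t, ∫⁻ y, ‖G s y‖ₑ ≤ N) :
    ∫⁻ x, ‖∫ s in Set.Ioc 0 t, heatDiv (t - s) (G s) x‖ₑ ≤ ENNReal.ofReal (4 * √t) * N :=
  (lintegral_mono fun _ => enorm_integral_le_lintegral_enorm _).trans
    (lintegral_lintegral_enorm_heatDiv_le ht hG hm hN).2

lemma ae_integrable_heatDiv (ht : 0 < t) (hG : ∀ s ∈ Set.Ioo 0 t, Integrable (G s))
    (hm : ∀ x, AEStronglyMeasurable (fun s => heatDiv (t - s) (G s) x)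
      (volume.restrict (Set.Ioc 0 t)))
    (hN : ∀ s ∈ Set.Ioo 0 t, ∫⁻ y, ‖G s y‖ₑ ≤ N) (hN' : N ≠ ∞) :
    ∀ᵐ x, IntegrableOn (fun s => heatDiv (t - s) (G s) x) (Set.Ioc 0 t) := by
  have h := lintegral_lintegral_enorm_heatDiv_le ht hG hm hN
  have hlt : ∀ᵐ x, ∫⁻ s in Set.Ioc 0 t, ‖heatDiv (t - s) (G s) x‖ₑ < ∞ :=
    ae_lt_top' h.1.lintegral_prod_left'
      (h.2.trans_lt (ENNReal.mul_lt_top ENNReal.ofReal_lt_top hN'.lt_top)).ne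
  exact hlt.mono fun x hx => ⟨hm x, hx⟩

/-- The `L¹` estimate for a function given by a Duhamel formula. -/
lemma lintegral_enorm_le_of_eq_heat_add {f g : E2 → ℝ} (ht : 0 < t) (hf : Integrable f)
    (hG : ∀ s ∈ Set.Ioo 0 t, Integrable (G s))
    (hm : ∀ x, AEStronglyMeasurable (fun s => heatDiv (t - s) (G s) x)
      (volume.restrict (Set.Ioc 0 t)))
    (hN : ∀ s ∈ Set.Ioo 0 t, ∫⁻ y, ‖G s y‖ₑ ≤ N)
    (hg : ∀ᵐ x, g x = heat t f x + ∫ s in Set.Ioc 0 t, heatDiv (t - s) (G s) x) :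
    ∫⁻ x, ‖g x‖ₑ ≤ (∫⁻ x, ‖f x‖ₑ) + ENNReal.ofReal (4 * √t) * N := by
  calc ∫⁻ x, ‖g x‖ₑ ≤ ∫⁻ x, ‖heat t f x‖ₑ + ‖∫ s in Set.Ioc 0 t, heatDiv (t - s) (G s) x‖ₑ := by
        refine lintegral_mono_ae (hg.mono fun x hx => ?_)
        rw [hx]
        exact enorm_add_le _ _
    _ = (∫⁻ x, ‖heat t f x‖ₑ) + ∫⁻ x, ‖∫ s in Set.Ioc 0 t, heatDiv (t - s) (G s) x‖ₑ :=
        lintegral_add_left (continuous_heat ht hf).measurable.enorm _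
    _ ≤ _ := add_le_add (lintegral_enorm_heat_le ht hf)
        (lintegral_enorm_integral_heatDiv_le ht hG hm hN)

end

/-! ### Integrability of the gradient from difference quotients -/

lemma lintegral_enorm_inner_gradient_le {f : E2 → ℝ} (hf : Differentiable ℝ f) {L : ℝ≥0∞}
    (hL : ∀ h : E2, ∫⁻ x, ‖f (x + h) - f x‖ₑ ≤ ‖h‖ₑ * L) (v : E2) :
    ∫⁻ x, ‖⟪gradient f x, v⟫‖ₑ ≤ ‖v‖ₑ * L := by
  let δ (n : ℕ) : ℝ := ((n : ℝ) + 1)⁻¹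
  have hδ (n : ℕ) : 0 < δ n := by positivity
  have hδ_lim : Tendsto δ atTop (𝓝[>] 0) := tendsto_nhdsWithin_iff.2
    ⟨tendsto_inv_atTop_zero.comp (tendsto_atTop_add_const_right _ _ tendsto_natCast_atTop_atTop),
      Eventually.of_forall hδ⟩
  have hlim (x : E2) : Tendsto (fun n => ‖(δ n)⁻¹ * (f (x + δ n • v) - f x)‖ₑ) atTop
      (𝓝 ‖⟪gradient f x, v⟫‖ₑ) := by
    have h := (hasDerivAt_comp_line hf x v 0).tendsto_slope_zero_right.comp hδ_lim
    simp only [zero_add, zero_smul, add_zero] at h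
    exact h.enorm
  calc ∫⁻ x, ‖⟪gradient f x, v⟫‖ₑ
      = ∫⁻ x, liminf (fun n => ‖(δ n)⁻¹ * (f (x + δ n • v) - f x)‖ₑ) atTop :=
        lintegral_congr fun x => (hlim x).liminf_eq.symm
    _ ≤ liminf (fun n => ∫⁻ x, ‖(δ n)⁻¹ * (f (x + δ n • v) - f x)‖ₑ) atTop := by
        refine lintegral_liminf_le fun n => Continuous.measurable ?_
        have := hf.continuous
        fun_prop
    _ ≤ ‖v‖ₑ * L := by
        refine liminf_le_of_le (by isBoundedDefault) fun b hb => ?_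
        obtain ⟨n, hn⟩ := hb.exists
        refine hn.trans ?_
        simp_rw [enorm_mul]
        rw [lintegral_const_mul' _ _ enorm_ne_top]
        calc _ ≤ ‖(δ n)⁻¹‖ₑ * (‖δ n • v‖ₑ * L) := by gcongr; exact hL _
          _ = ‖v‖ₑ * L := by
            rw [enorm_smul, ← mul_assoc, ← mul_assoc, ← enorm_mul, inv_mul_cancel₀ (hδ n).ne',
              enorm_one, one_mul]

lemma lintegral_enorm_gradient_le {f : E2 → ℝ} (hf : Differentiable ℝ f) {L : ℝ≥0∞}
    (hL : ∀ h : E2, ∫⁻ x, ‖f (x + h) - f x‖ₑ ≤ ‖h‖ₑ * L) :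
    ∫⁻ x, ‖gradient f x‖ₑ ≤ 2 * L := by
  let e := EuclideanSpace.basisFun (Fin 2) ℝ
  have he (i : Fin 2) : ‖e i‖ₑ = 1 := by
    rw [← ofReal_norm, e.orthonormal.1 i, ENNReal.ofReal_one]
  have h (x : E2) : ‖gradient f x‖ₑ ≤ ∑ i, ‖⟪gradient f x, e i⟫‖ₑ := by
    conv_lhs => rw [← e.sum_repr' (gradient f x)]
    refine (enorm_sum_le _ _).trans (Finset.sum_le_sum fun i _ => ?_)
    rw [enorm_smul, he, mul_one, real_inner_comm]
  calc ∫⁻ x, ‖gradient f x‖ₑ ≤ ∫⁻ x, ∑ i, ‖⟪gradient f x, e i⟫‖ₑ := lintegral_mono h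
    _ = ∑ i, ∫⁻ x, ‖⟪gradient f x, e i⟫‖ₑ :=
        lintegral_finsetSum _ fun i _ => (measurable_gradient.inner measurable_const).enorm
    _ ≤ ∑ i, ‖e i‖ₑ * L := Finset.sum_le_sum fun i _ => lintegral_enorm_inner_gradient_le hf hL _
    _ = 2 * L := by simp [he]

/-! ### Stability of mild solutions -/

section

variable {ω₀ ω₀' : E2 → ℝ} {T : ℝ} {ω ω' : ℝ → E2 → ℝ} {B M : ℝ≥0∞}

lemma IsMildSolution.ae_sub_eq (h₀ : MemW11 ω₀) (h₀' : MemW11 ω₀')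
    (hω : ∀ t ∈ Set.Ioc 0 T, MemW11 (ω t) ∧ W11 (ω t) ≤ B)
    (hω' : ∀ t ∈ Set.Ioc 0 T, MemW11 (ω' t) ∧ W11 (ω' t) ≤ B) (hB : B ≠ ∞)
    (hmild : IsMildSolution ω₀ T ω) (hmild' : IsMildSolution ω₀' T ω')
    {t : ℝ} (ht : t ∈ Set.Ioc 0 T) :
    ∀ᵐ x, ω' t x - ω t x = heat t (fun y => ω₀' y - ω₀ y) x +
      ∫ s in Set.Ioc 0 t, heatDiv (t - s) (fun y => flux ω' s y - flux ω s y) x := by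
  have hint {ω₀ : E2 → ℝ} {ω : ℝ → E2 → ℝ} (h₀ : MemW11 ω₀)
      (hω : ∀ t ∈ Set.Ioc 0 T, MemW11 (ω t) ∧ W11 (ω t) ≤ B) (hmild : IsMildSolution ω₀ T ω) :
      ∀ᵐ x, IntegrableOn (fun s => heatDiv (t - s) (flux ω s) x) (Set.Ioc 0 t) := by
    refine ae_integrable_heatDiv ht.1
      (fun s hs => integrable_flux (fun t ht => (hω t ht).1) ⟨hs.1, hs.2.le.trans ht.2⟩)
      (duhamelMeasurable h₀ (fun t ht => (hω t ht).1) hmild ht) (N := B * B) (fun s hs => ?_)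
      (ENNReal.mul_ne_top hB hB)
    obtain ⟨h1, h2⟩ := hω s ⟨hs.1, hs.2.le.trans ht.2⟩
    exact (lintegral_enorm_vortFlux_le h1.measurable h1).trans (mul_le_mul'
      ((lintegral_enorm_le_W11 _).trans h2) ((lintegral_enorm_gradient_le_W11 _).trans h2))
  filter_upwards [hint h₀ hω hmild, hint h₀' hω' hmild'] with x hx hx'
  rw [hmild.eq_heat_add ht, hmild'.eq_heat_add ht, heat_sub ht.1 h₀'.1 h₀.1]
  have hsub : ∫ s in Set.Ioc 0 t, heatDiv (t - s) (fun y => flux ω' s y - flux ω s y) x =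
      ∫ s in Set.Ioc 0 t, (heatDiv (t - s) (flux ω' s) x - heatDiv (t - s) (flux ω s) x) := by
    refine integral_congr_ae ?_
    filter_upwards [ae_restrict_Ioc_lt t] with s hs
    have hsT : s ∈ Set.Ioc 0 T := ⟨hs.1, hs.2.le.trans ht.2⟩
    exact heatDiv_sub (sub_pos.2 hs.2) (integrable_flux (fun t ht => (hω' t ht).1) hsT)
      (integrable_flux (fun t ht => (hω t ht).1) hsT) x
  rw [hsub, integral_sub hx' hx]
  ring

lemma IsMildSolution.W11_sub_le (h₀ : MemW11 ω₀) (h₀' : MemW11 ω₀')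
    (hω : ∀ t ∈ Set.Ioc 0 T, MemW11 (ω t) ∧ W11 (ω t) ≤ B)
    (hω' : ∀ t ∈ Set.Ioc 0 T, MemW11 (ω' t) ∧ W11 (ω' t) ≤ B) (hB : B ≠ ∞)
    (hmild : IsMildSolution ω₀ T ω) (hmild' : IsMildSolution ω₀' T ω') (hM_top : M ≠ ∞)
    (hM : ∀ t ∈ Set.Ioc 0 T, W11 (fun x => ω' t x - ω t x) ≤ M)
    {t : ℝ} (ht : t ∈ Set.Ioc 0 T) :
    W11 (fun x => ω' t x - ω t x) ≤ 3 * W11 (fun x => ω₀' x - ω₀ x) +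
      5 * (ENNReal.ofReal (4 * √t) * (M * (B + B))) := by
  have hd₀ : MemW11 (fun y => ω₀' y - ω₀ y) := h₀'.sub h₀
  have hmem {s : ℝ} (hs : s ∈ Set.Ioo 0 t) : s ∈ Set.Ioc 0 T := ⟨hs.1, hs.2.le.trans ht.2⟩
  let G (s : ℝ) (y : E2) : E2 := flux ω' s y - flux ω s y
  have hFi : ∀ s ∈ Set.Ioo 0 t, Integrable (flux ω s) := fun s hs =>
    integrable_flux (fun t ht => (hω t ht).1) (hmem hs)
  have hFi' : ∀ s ∈ Set.Ioo 0 t, Integrable (flux ω' s) := fun s hs =>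
    integrable_flux (fun t ht => (hω' t ht).1) (hmem hs)
  have hGi : ∀ s ∈ Set.Ioo 0 t, Integrable (G s) := fun s hs => (hFi' s hs).sub (hFi s hs)
  have hGm (x : E2) : AEStronglyMeasurable (fun s => heatDiv (t - s) (G s) x)
      (volume.restrict (Set.Ioc 0 t)) := by
    refine ((duhamelMeasurable h₀' (fun t ht => (hω' t ht).1) hmild' ht x).sub
      (duhamelMeasurable h₀ (fun t ht => (hω t ht).1) hmild ht x)).congr ?_
    filter_upwards [ae_restrict_Ioc_lt t] with s hs
    exact (heatDiv_sub (sub_pos.2 hs.2) (hFi' s hs) (hFi s hs) x).symm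
  have hWN : ∀ s ∈ Set.Ioo 0 t, W11 (fun x => ω' s x - ω s x) * (W11 (ω' s) + W11 (ω s)) ≤
      M * (B + B) := fun s hs => mul_le_mul' (hM s (hmem hs))
        (add_le_add (hω' s (hmem hs)).2 (hω s (hmem hs)).2)
  have hGN : ∀ s ∈ Set.Ioo 0 t, ∫⁻ y, ‖G s y‖ₑ ≤ M * (B + B) := fun s hs =>
    (lintegral_enorm_vortFlux_self_sub_le (hω' s (hmem hs)).1 (hω s (hmem hs)).1).trans (hWN s hs)
  have hae := hmild.ae_sub_eq h₀ h₀' hω hω' hB hmild' ht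
  set Φ := ENNReal.ofReal (4 * √t)
  have h1 : ∫⁻ x, ‖ω' t x - ω t x‖ₑ ≤ W11 (fun x => ω₀' x - ω₀ x) + Φ * (M * (B + B)) :=
    (lintegral_enorm_le_of_eq_heat_add ht.1 hd₀.1 hGi hGm hGN hae).trans
      (add_le_add_left (lintegral_enorm_le_W11 _) _)
  have h2 (h : E2) : ∫⁻ x, ‖(ω' t (x + h) - ω t (x + h)) - (ω' t x - ω t x)‖ₑ ≤
      ‖h‖ₑ * (W11 (fun x => ω₀' x - ω₀ x) + 2 * (Φ * (M * (B + B)))) := by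
    have hGhi : ∀ s ∈ Set.Ioo 0 t, Integrable (fun y => G s (y + h)) := fun s hs =>
      (hGi s hs).comp_add_right h
    have hsub : ∀ s ∈ Set.Ioo 0 t, ∀ x, heatDiv (t - s) (fun y => G s (y + h) - G s y) x =
        heatDiv (t - s) (G s) (x + h) - heatDiv (t - s) (G s) x := fun s hs x => by
      rw [heatDiv_sub (sub_pos.2 hs.2) (hGhi s hs) (hGi s hs), heatDiv_comp_add_right]
    have hae_int := ae_integrable_heatDiv ht.1 hGi hGm hGN
      (ENNReal.mul_ne_top hM_top (ENNReal.add_ne_top.2 ⟨hB, hB⟩))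
    have hshift := (measurePreserving_add_right (volume : Measure E2) h).quasiMeasurePreserving
    have h5 := lintegral_enorm_le_of_eq_heat_add
      (f := fun y => (ω₀' (y + h) - ω₀ (y + h)) - (ω₀' y - ω₀ y))
      (g := fun x => (ω' t (x + h) - ω t (x + h)) - (ω' t x - ω t x))
      (G := fun s y => G s (y + h) - G s y) (N := 2 * ‖h‖ₑ * (M * (B + B))) ht.1
      ((hd₀.1.comp_add_right h).sub hd₀.1) (fun s hs => (hGhi s hs).sub (hGi s hs))
      (fun x => by
        refine ((hGm (x + h)).sub (hGm x)).congr ?_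
        filter_upwards [ae_restrict_Ioc_lt t] with s hs
        exact (hsub s hs x).symm)
      (fun s hs => (lintegral_enorm_translate_vortFlux_self_sub_le (hω' s (hmem hs)).1
        (hω s (hmem hs)).1 h).trans (mul_le_mul_right (hWN s hs) _))
      (by
        filter_upwards [hae, hshift.ae hae, hae_int, hshift.ae hae_int] with x hx hxh hi hih
        rw [hx, hxh, heat_sub ht.1 (hd₀.1.comp_add_right h) hd₀.1,
          heat_comp_add_right t (fun y => ω₀' y - ω₀ y)]
        have hI : ∫ s in Set.Ioc 0 t, heatDiv (t - s) (fun y => G s (y + h) - G s y) x =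
            ∫ s in Set.Ioc 0 t, (heatDiv (t - s) (G s) (x + h) - heatDiv (t - s) (G s) x) := by
          refine integral_congr_ae ?_
          filter_upwards [ae_restrict_Ioc_lt t] with s hs
          exact hsub s hs x
        rw [hI, integral_sub hih hi]
        ring)
    refine h5.trans ?_
    calc _ ≤ ‖h‖ₑ * W11 (fun x => ω₀' x - ω₀ x) + Φ * (2 * ‖h‖ₑ * (M * (B + B))) :=
          add_le_add_left ((lintegral_enorm_translate_sub_le hd₀.2.1 h).trans
            (mul_le_mul_right (lintegral_enorm_gradient_le_W11 _) _)) _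
      _ = _ := by ring
  have h3 := lintegral_enorm_gradient_le ((hω' t ht).1.sub (hω t ht).1).2.1 h2
  rw [W11, eLpNorm_one_eq_lintegral_enorm, eLpNorm_one_eq_lintegral_enorm]
  refine (add_le_add h1 h3).trans_eq ?_
  ring

end

lemma ENNReal.le_two_mul_of_le_add_half {a M : ℝ≥0∞} (hM : M ≠ ∞) (h : M ≤ a + M / 2) :
    M ≤ 2 * a := by
  have h2 : M / 2 ≤ a := by
    refine ENNReal.le_of_add_le_add_right (ENNReal.div_ne_top hM two_ne_zero) (?_ : _ ≤ a + M / 2)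
    rwa [ENNReal.add_halves]
  calc M = M / 2 + M / 2 := (ENNReal.add_halves M).symm
    _ ≤ a + a := add_le_add h2 h2
    _ = 2 * a := (two_mul a).symm

/-- On a time interval of length `A₀⁻² / 6400`, two mild solutions of size `A₀` stay close. -/
lemma iSup_W11_sub_le {A₀ : ℝ} (hA₀ : 0 < A₀) {ω₀ ω₀' : E2 → ℝ} {ω ω' : ℝ → E2 → ℝ}
    (h₀ : MemW11 ω₀) (h₀' : MemW11 ω₀')
    (hω : ∀ t ∈ Set.Ioc 0 (1 / 6400 / A₀ ^ 2), MemW11 (ω t) ∧ W11 (ω t) ≤ ENNReal.ofReal A₀)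
    (hω' : ∀ t ∈ Set.Ioc 0 (1 / 6400 / A₀ ^ 2), MemW11 (ω' t) ∧ W11 (ω' t) ≤ ENNReal.ofReal A₀)
    (hmild : IsMildSolution ω₀ (1 / 6400 / A₀ ^ 2) ω)
    (hmild' : IsMildSolution ω₀' (1 / 6400 / A₀ ^ 2) ω') :
    ⨆ t ∈ Set.Ioc 0 (1 / 6400 / A₀ ^ 2), W11 (fun x => ω' t x - ω t x) ≤
      2 * (3 * W11 (fun x => ω₀' x - ω₀ x)) := by
  set M := ⨆ t ∈ Set.Ioc 0 (1 / 6400 / A₀ ^ 2), W11 (fun x => ω' t x - ω t x)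
  have hle : ∀ t ∈ Set.Ioc 0 (1 / 6400 / A₀ ^ 2), W11 (fun x => ω' t x - ω t x) ≤ M :=
    fun t ht => le_iSup₂ (f := fun t _ => W11 (fun x => ω' t x - ω t x)) t ht
  have hM : M ≠ ∞ := by
    refine ne_top_of_le_ne_top (ENNReal.add_ne_top.2
      ⟨ENNReal.ofReal_ne_top (r := A₀), ENNReal.ofReal_ne_top (r := A₀)⟩) (iSup₂_le fun t ht => ?_)
    exact ((hω' t ht).1.W11_sub_le (hω t ht).1).trans (add_le_add (hω' t ht).2 (hω t ht).2)
  refine ENNReal.le_two_mul_of_le_add_half hM (iSup₂_le fun t ht => ?_)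
  refine (hmild.W11_sub_le h₀ h₀' hω hω' ENNReal.ofReal_ne_top hmild' hM hle ht).trans ?_
  refine add_le_add_right ?_ _
  have hsqrt : √t ≤ 1 / (80 * A₀) := by
    refine Real.sqrt_le_iff.2 ⟨by positivity, ht.2.trans_eq ?_⟩
    field_simp
    norm_num
  calc 5 * (ENNReal.ofReal (4 * √t) * (M * (ENNReal.ofReal A₀ + ENNReal.ofReal A₀)))
      = ENNReal.ofReal (5 * (4 * √t) * (A₀ + A₀)) * M := by
        rw [ENNReal.ofReal_mul (p := 5 * (4 * √t)) (by positivity),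
          ENNReal.ofReal_mul (p := 5) (by norm_num), ENNReal.ofReal_add hA₀.le hA₀.le,
          ENNReal.ofReal_ofNat]
        ring
    _ ≤ ENNReal.ofReal (1 / 2) * M := by
        gcongr
        calc 5 * (4 * √t) * (A₀ + A₀) ≤ 5 * (4 * (1 / (80 * A₀))) * (A₀ + A₀) := by gcongr
          _ = 1 / 2 := by field_simp; norm_num
    _ = M / 2 := by
        rw [ENNReal.ofReal_div_of_pos two_pos, ENNReal.ofReal_one, ENNReal.ofReal_ofNat,
          one_div, mul_comm, ENNReal.div_eq_inv_mul, mul_comm]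

/-- **Continuous dependence on the initial data (Theorem 1).** With the
constants `C, c` of the local well-posedness theorem: if initial data
`ω₀⁽ⁱ⁾ ∈ W^{1,1}(ℝ²)`, all of `W^{1,1}`-norm at most `A₀`, converge in
`W^{1,1}(ℝ²)` to `ω₀`, and `ω⁽ⁱ⁾, ω` are the corresponding mild solutions of
the vorticity equation on `(0, t₀]`, `t₀ = C/A₀²`, then
`sup_{0<t≤t₀} ‖ω⁽ⁱ⁾(·,t) − ω(·,t)‖_{W^{1,1}} → 0` as `i → ∞`. -/
theorem vorticity_continuous_dependence :
    ∃ C : ℝ, 0 < C ∧ ∃ c : ℝ, 0 < c ∧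
      ∀ (A₀ : ℝ), 0 < A₀ →
      ∀ (ω₀ : E2 → ℝ) (ω₀' : ℕ → E2 → ℝ),
        MemW11 ω₀ → W11 ω₀ ≤ ENNReal.ofReal A₀ →
        (∀ i, MemW11 (ω₀' i) ∧ W11 (ω₀' i) ≤ ENNReal.ofReal A₀) →
        Filter.Tendsto (fun i => W11 (fun x => ω₀' i x - ω₀ x)) Filter.atTop (nhds 0) →
        ∀ (ω : ℝ → E2 → ℝ) (ω' : ℕ → ℝ → E2 → ℝ),
          ((∀ t ∈ Set.Ioc (0 : ℝ) (C / A₀ ^ 2),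
              MemW11 (ω t) ∧ W11 (ω t) ≤ ENNReal.ofReal (c * A₀)) ∧
            IsMildSolution ω₀ (C / A₀ ^ 2) ω) →
          (∀ i, (∀ t ∈ Set.Ioc (0 : ℝ) (C / A₀ ^ 2),
              MemW11 (ω' i t) ∧ W11 (ω' i t) ≤ ENNReal.ofReal (c * A₀)) ∧
            IsMildSolution (ω₀' i) (C / A₀ ^ 2) (ω' i)) →
          Filter.Tendsto
            (fun i => ⨆ t ∈ Set.Ioc (0 : ℝ) (C / A₀ ^ 2),
              W11 (fun x => ω' i t x - ω t x))
            Filter.atTop (nhds 0) := by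
  refine ⟨1 / 25600, by norm_num, 2, two_pos, ?_⟩
  intro A₀ hA₀ ω₀ ω₀' h₀ _ h₀' hlim ω ω' hω hω'
  have hC : (1 / 25600 : ℝ) / A₀ ^ 2 = 1 / 6400 / (2 * A₀) ^ 2 := by
    field_simp
    norm_num
  rw [hC] at hω hω' ⊢
  have h0 : Tendsto (fun i => 2 * (3 * W11 (fun x => ω₀' i x - ω₀ x))) atTop (𝓝 0) := by
    simpa using ENNReal.Tendsto.const_mul (ENNReal.Tendsto.const_mul hlim
      (Or.inr ENNReal.ofNat_ne_top)) (Or.inr ENNReal.ofNat_ne_top)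
  exact tendsto_of_tendsto_of_tendsto_of_le_of_le tendsto_const_nhds h0 (fun _ => zero_le)
    fun i => iSup_W11_sub_le (by positivity) h₀ (h₀' i).1 hω.1 (hω' i).1 hω.2 (hω' i).2

end
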